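/- Let (ρ_k)_{k∈ℤⁿ} be a toroidal symbol in 𝕊^m(ℤⁿ;𝒜_θ), m ∈ ℝ. Then there exists a standard symbol ρ̃ ∈ 𝕊^m(ℝⁿ;𝒜_θ) such that ρ̃(k) = ρ_k for all k ∈ ℤⁿ. Moreover, ρ̃ is unique modulo 𝒮(ℝⁿ;𝒜_θ): if ρ̃₁, ρ̃₂ ∈ 𝕊^m(ℝⁿ;𝒜_θ) both restrict to (ρ_k) on ℤⁿ, then ρ̃₁ − ρ̃₂ ∈ 𝒮(ℝⁿ;𝒜_θ). -/

import Mathlib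

open Complex Filter Topology
open scoped ComplexOrder Real BigOperators

noncomputable section

/-- Euclidean space `ℝⁿ`. -/
abbrev Rn (n : ℕ) : Type := EuclideanSpace ℝ (Fin n)

/-- `ℝⁿ × ℝⁿ`. -/
abbrev R2n (n : ℕ) : Type := Rn n × Rn n

/-- Length `|β|` of a multi-order `β ∈ ℕ₀ⁿ`. -/
def mdeg {n : ℕ} (b : Fin n → ℕ) : ℕ := ∑ j, b j

/-- Composition of a list of self-maps. -/
def compList {X : Type*} (l : List (X → X)) : X → X := l.foldr (· ∘ ·) id

/-- The phase `c(k,l) = Σ_{q<p} k_p θ_{pq} l_q`. -/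
def cPhase {n : ℕ} (θ : Matrix (Fin n) (Fin n) ℝ) (k l : Fin n → ℤ) : ℝ :=
  ∑ p, ∑ q, if q < p then (k p : ℝ) * θ p q * (l q : ℝ) else 0

/-- Euclidean norm `|k|` of a lattice point `k ∈ ℤⁿ`. -/
def znorm {n : ℕ} (k : Fin n → ℤ) : ℝ := Real.sqrt (∑ j, ((k j : ℝ)) ^ 2)

/-- `k^β = ∏ k_jᵝ`. -/
def kpow {n : ℕ} (b : Fin n → ℕ) (k : Fin n → ℤ) : ℝ := ∏ j, ((k j : ℝ)) ^ (b j)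

/-- A lattice point `k ∈ ℤⁿ` viewed as a point of `ℝⁿ`. -/
def zEmb {n : ℕ} (k : Fin n → ℤ) : Rn n := (WithLp.equiv 2 (Fin n → ℝ)).symm (fun j => (k j : ℝ))

variable {n : ℕ} {A : Type} [NormedRing A] [StarRing A] [CStarRing A]
  [NormedAlgebra ℂ A] [StarModule ℂ A] [CompleteSpace A]

/-- The derivation `δ_j u = (1/i) ∂_{s_j} α_s(u)|_{s=0}`. -/
def δd (αa : Rn n → (A ≃⋆ₐ[ℂ] A)) (j : Fin n) (u : A) : A :=
  (-Complex.I) • fderiv ℝ (fun s : Rn n => αa s u) 0 (EuclideanSpace.single j 1)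

/-- `δ^β = δ_1^{β_1} ⋯ δ_n^{β_n}`. -/
def δpow (αa : Rn n → (A ≃⋆ₐ[ℂ] A)) (b : Fin n → ℕ) : A → A :=
  compList (List.ofFn fun j => (δd αa j)^[b j])

/-- The smooth noncommutative torus `𝒜_θ`: elements with `C^∞` orbit map. -/
def SmoothSet (αa : Rn n → (A ≃⋆ₐ[ℂ] A)) : Set A :=
  {u | ∀ N : ℕ, ContDiff ℝ N (fun s : Rn n => αa s u)}

/-- `A_θ^{(N)}`: elements with `C^N` orbit map. -/
def CNSet (αa : Rn n → (A ≃⋆ₐ[ℂ] A)) (N : ℕ) : Set A :=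
  {u | ContDiff ℝ N (fun s : Rn n => αa s u)}

/-- The Fréchet seminorms `‖u‖_{(N)} = sup_{|β| ≤ N} ‖δ^β(u)‖` of `𝒜_θ`. -/
def frSemi (αa : Rn n → (A ≃⋆ₐ[ℂ] A)) (N : ℕ) (u : A) : ℝ :=
  ⨆ b : {b : Fin n → ℕ // mdeg b ≤ N}, ‖δpow αa b.1 u‖

/-- Partial derivative `∂_{ξ_j}` of maps `ℝⁿ → A`. -/
def pd {n : ℕ} (j : Fin n) (f : Rn n → A) : Rn n → A :=
  fun ξ => fderiv ℝ f ξ (EuclideanSpace.single j 1)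

/-- Iterated partial derivative `∂_ξ^β` of maps `ℝⁿ → A`. -/
def pdPow {n : ℕ} (b : Fin n → ℕ) : (Rn n → A) → (Rn n → A) :=
  compList (List.ofFn fun j => (pd j)^[b j])

/-- Partial derivative `∂_{s_j}` (first variable) of maps `ℝⁿ×ℝⁿ → A`. -/
def pdS {n : ℕ} (j : Fin n) (f : R2n n → A) : R2n n → A :=
  fun x => fderiv ℝ f x (EuclideanSpace.single j 1, 0)

/-- Partial derivative `∂_{ξ_j}` (second variable) of maps `ℝⁿ×ℝⁿ → A`. -/
def pdXi {n : ℕ} (j : Fin n) (f : R2n n → A) : R2n n → A :=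
  fun x => fderiv ℝ f x (0, EuclideanSpace.single j 1)

/-- `∂_s^β`. -/
def pdSPow {n : ℕ} (b : Fin n → ℕ) : (R2n n → A) → (R2n n → A) :=
  compList (List.ofFn fun j => (pdS j)^[b j])

/-- `∂_ξ^γ`. -/
def pdXiPow {n : ℕ} (b : Fin n → ℕ) : (R2n n → A) → (R2n n → A) :=
  compList (List.ofFn fun j => (pdXi j)^[b j])

/-- Forward difference operator `Δ_j` on maps `ℝⁿ → A`. -/
def fdiff {n : ℕ} (j : Fin n) (f : Rn n → A) : Rn n → A :=
  fun ξ => f (ξ + EuclideanSpace.single j 1) - f ξ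

/-- `Δ^β` on maps `ℝⁿ → A`. -/
def fdiffPow {n : ℕ} (b : Fin n → ℕ) : (Rn n → A) → (Rn n → A) :=
  compList (List.ofFn fun j => (fdiff j)^[b j])

/-- Forward difference operator `Δ_j` on sequences `ℤⁿ → A`. -/
def zdiff {n : ℕ} (j : Fin n) (f : (Fin n → ℤ) → A) : (Fin n → ℤ) → A :=
  fun k => f (k + Pi.single j 1) - f k

/-- `Δ^β` on sequences `ℤⁿ → A`. -/
def zdiffPow {n : ℕ} (b : Fin n → ℕ) : ((Fin n → ℤ) → A) → ((Fin n → ℤ) → A) :=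
  compList (List.ofFn fun j => (zdiff j)^[b j])

/-- The symbol class `𝕊^m(ℝⁿ; 𝒜_θ)`. -/
def IsSymbol (αa : Rn n → (A ≃⋆ₐ[ℂ] A)) (m : ℝ) (ρ : Rn n → A) : Prop :=
  (∀ ξ, ρ ξ ∈ SmoothSet αa) ∧
  (∀ a : Fin n → ℕ, ∀ N : ℕ, ContDiff ℝ N fun ξ => δpow αa a (ρ ξ)) ∧
  (∀ a b : Fin n → ℕ, ∃ C > 0, ∀ ξ,
    ‖δpow αa a (pdPow b ρ ξ)‖ ≤ C * (1 + ‖ξ‖) ^ (m - (mdeg b : ℝ)))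

/-- The class `𝒮(ℝⁿ; 𝒜_θ) = ∩ₘ 𝕊^m(ℝⁿ; 𝒜_θ)`. -/
def IsSchwartzSym (αa : Rn n → (A ≃⋆ₐ[ℂ] A)) (ρ : Rn n → A) : Prop :=
  ∀ m : ℝ, IsSymbol αa m ρ

/-- The seminorm `p_N^{(m)}` on `𝕊^m(ℝⁿ; 𝒜_θ)`. -/
def pSemi (αa : Rn n → (A ≃⋆ₐ[ℂ] A)) (m : ℝ) (N : ℕ) (ρ : Rn n → A) : ℝ :=
  ⨆ q : {ab : (Fin n → ℕ) × (Fin n → ℕ) // mdeg ab.1 + mdeg ab.2 ≤ N} × Rn n,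
    (1 + ‖q.2‖) ^ (-m + (mdeg q.1.1.2 : ℝ)) * ‖δpow αa q.1.1.1 (pdPow q.1.1.2 ρ q.2)‖

/-- The amplitude class `A^m(ℝⁿ×ℝⁿ; 𝒜_θ)`. -/
def IsAmplitude (αa : Rn n → (A ≃⋆ₐ[ℂ] A)) (m : ℝ) (a : R2n n → A) : Prop :=
  (∀ x, a x ∈ SmoothSet αa) ∧
  (∀ c : Fin n → ℕ, ∀ N : ℕ, ContDiff ℝ N fun x => δpow αa c (a x)) ∧
  (∀ c b g : Fin n → ℕ, ∃ C > 0, ∀ x : R2n n,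
    ‖δpow αa c (pdSPow b (pdXiPow g a) x)‖ ≤ C * (1 + ‖x.1‖ + ‖x.2‖) ^ m)

/-- The seminorm `q_N^{(m)}` on `A^m(ℝⁿ×ℝⁿ; 𝒜_θ)`. -/
def qSemi (αa : Rn n → (A ≃⋆ₐ[ℂ] A)) (m : ℝ) (N : ℕ) (a : R2n n → A) : ℝ :=
  ⨆ q : {t : (Fin n → ℕ) × (Fin n → ℕ) × (Fin n → ℕ) //
      mdeg t.1 + mdeg t.2.1 + mdeg t.2.2 ≤ N} × R2n n,
    (1 + ‖q.2.1‖ + ‖q.2.2‖) ^ (-m) *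
      ‖δpow αa q.1.1.1 (pdSPow q.1.1.2.1 (pdXiPow q.1.1.2.2 a) q.2)‖

/-- The toroidal symbol class `𝕊^m(ℤⁿ; 𝒜_θ)`. -/
def IsToroidal (αa : Rn n → (A ≃⋆ₐ[ℂ] A)) (m : ℝ) (ρ : (Fin n → ℤ) → A) : Prop :=
  (∀ k, ρ k ∈ SmoothSet αa) ∧
  (∀ a b : Fin n → ℕ, ∃ C > 0, ∀ k,
    ‖δpow αa a (zdiffPow b ρ k)‖ ≤ C * (1 + znorm k) ^ (m - (mdeg b : ℝ)))

/-- The coefficient `(1-χ)/(|s|²+|ξ|²)` of the operator `L`. -/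
def Lcoef {n : ℕ} (χc : R2n n → ℝ) (x : R2n n) : ℝ := (1 - χc x) / (‖x.1‖ ^ 2 + ‖x.2‖ ^ 2)

/-- The transpose `L^t` of `L = χ + (1-χ)(|s|²+|ξ|²)^{-1} Σ (ξ_j D_{s_j} + s_j D_{ξ_j})`,
namely `L^t u = χ u - Σ_j (D_{s_j}((1-χ)(|s|²+|ξ|²)^{-1} ξ_j u) + D_{ξ_j}(… s_j u))`. -/
def Ltrans (χc : R2n n → ℝ) (u : R2n n → A) : R2n n → A := fun x =>
  χc x • u x -
    ∑ j, ((-Complex.I) • pdS j (fun y => (Lcoef χc y * y.2 j) • u y) x +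
      (-Complex.I) • pdXi j (fun y => (Lcoef χc y * y.1 j) • u y) x)

/-- The (regularized) oscillating integral `(2π)^{-n} ∬ e^{is·ξ} (L^t)^N[a(s,ξ)] ds dξ`. -/
def Josc (χc : R2n n → ℝ) (N : ℕ) (a : R2n n → A) : A :=
  ((2 * Real.pi) ^ n)⁻¹ •
    MeasureTheory.integral MeasureTheory.volume
      (fun x : R2n n => Complex.exp (Complex.I * ((∑ j, x.1 j * x.2 j : ℝ) : ℂ)) •
        ((Ltrans χc)^[N] a) x)

/-- A convenient integer `> m + 2n`. -/
def Nfor (n : ℕ) (m : ℝ) : ℕ := ⌈m⌉₊ + 2 * n + 1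

set_option linter.unusedSectionVars false

/-! ### Words of operators -/

/-- The composite `T_{j₁} ∘ ⋯ ∘ T_{j_r}` of a word `j₁ ⋯ j_r`. -/
def applyWord {ι X : Type*} (T : ι → X → X) (w : List ι) (x : X) : X := w.foldr T x

@[simp] lemma applyWord_nil {ι X : Type*} (T : ι → X → X) (x : X) : applyWord T [] x = x := rfl

@[simp] lemma applyWord_cons {ι X : Type*} (T : ι → X → X) (j : ι) (w : List ι) (x : X) :
    applyWord T (j :: w) x = T j (applyWord T w x) := rfl

lemma applyWord_append {ι X : Type*} (T : ι → X → X) (w w' : List ι) (x : X) :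
    applyWord T (w ++ w') x = applyWord T w (applyWord T w' x) := by
  simp [applyWord]

/-- Relations between two families of operators extend to words. -/
lemma applyWord_rel {ι X Y : Type*} {S : ι → X → X} {P : ι → Y → Y} {R : X → Y → Prop}
    (h : ∀ j x y, R x y → R (S j x) (P j y)) (w : List ι) {x : X} {y : Y} (hxy : R x y) :
    R (applyWord S w x) (applyWord P w y) := by
  induction w with
  | nil => exact hxy
  | cons j w ih => exact h _ _ _ ih

lemma applyWord_mem {ι X : Type*} {T : ι → X → X} {D : Set X} (hD : ∀ j, ∀ x ∈ D, T j x ∈ D)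
    (w : List ι) {x : X} (hx : x ∈ D) : applyWord T w x ∈ D := by
  induction w with
  | nil => exact hx
  | cons j w ih => exact hD _ _ ih

lemma applyWord_perm {ι X : Type*} {T : ι → X → X} {D : Set X} (hD : ∀ j, ∀ x ∈ D, T j x ∈ D)
    (hT : ∀ i j, ∀ x ∈ D, T i (T j x) = T j (T i x)) {w w' : List ι} (hw : w.Perm w')
    {x : X} (hx : x ∈ D) : applyWord T w x = applyWord T w' x := by
  induction hw with
  | nil => rfl
  | cons j _ ih => simp [ih]
  | swap i j l => simpa using hT _ _ _ (applyWord_mem hD l hx)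
  | trans _ _ h₁ h₂ => exact h₁.trans h₂

/-- The ordered word in which the letter `j` occurs `b j` times. -/
def multiWord (b : Fin n → ℕ) : List (Fin n) :=
  (List.finRange n).flatMap fun j => List.replicate (b j) j

lemma length_multiWord (b : Fin n → ℕ) : (multiWord b).length = mdeg b := by
  simp [multiWord, mdeg, List.length_flatMap, ← List.ofFn_eq_map, List.sum_ofFn]

lemma count_multiWord (b : Fin n → ℕ) (i : Fin n) : (multiWord b).count i = b i := by
  simp only [multiWord, List.count_flatMap, Function.comp_def, ← List.ofFn_eq_map, List.sum_ofFn,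
    List.count_replicate]
  simp

lemma compList_eq_applyWord {X : Type*} (T : Fin n → X → X) (b : Fin n → ℕ) (x : X) :
    compList (List.ofFn fun j => (T j)^[b j]) x = applyWord T (multiWord b) x := by
  rw [List.ofFn_eq_map, multiWord]
  generalize List.finRange n = l
  induction l with
  | nil => rfl
  | cons j l ih =>
    have key : ∀ (k : ℕ) (y : X), (T j)^[k] y = applyWord T (List.replicate k j) y := by
      intro k y
      induction k with
      | zero => rfl
      | succ k ihk => rw [Function.iterate_succ_apply', ihk]; rfl
    simp only [List.flatMap_cons, applyWord_append, ← ih, ← key]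
    rfl

lemma applyWord_eq_compList {X : Type*} {T : Fin n → X → X} {D : Set X}
    (hD : ∀ j, ∀ x ∈ D, T j x ∈ D) (hT : ∀ i j, ∀ x ∈ D, T i (T j x) = T j (T i x))
    (w : List (Fin n)) {x : X} (hx : x ∈ D) :
    applyWord T w x = compList (List.ofFn fun j => (T j)^[w.count j]) x := by
  rw [compList_eq_applyWord]
  exact applyWord_perm hD hT (List.perm_iff_count.2 fun i => (count_multiWord (fun j => w.count j) i).symm) hx

lemma mdeg_count (w : List (Fin n)) : mdeg (fun j => w.count j) = w.length := by
  rw [← length_multiWord]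
  exact (List.perm_iff_count.2 fun i => count_multiWord _ i).length_eq

/-! ### Smooth vectors of the action -/

section Action

variable (αa : Rn n → (A ≃⋆ₐ[ℂ] A))

/-- The automorphism `α_s` as a real continuous linear map. -/
def actionCLM (hαiso : ∀ s (u : A), ‖αa s u‖ = ‖u‖) (s : Rn n) : A →L[ℝ] A :=
  LinearMap.mkContinuous
    { toFun := αa s
      map_add' := map_add _
      map_smul' := fun c x => by
        have := map_smul (αa s) (c : ℂ) x
        simpa using this } 1 fun u => by simp [hαiso]

/-- The linear form `s ↦ i ∑ s_j v_j`. -/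
def gradForm (v : Fin n → A) : Rn n →L[ℝ] A :=
  ∑ j, (EuclideanSpace.proj j : Rn n →L[ℝ] ℝ).smulRight (Complex.I • v j)

lemma gradForm_apply (v : Fin n → A) (s : Rn n) :
    gradForm v s = ∑ j, s j • (Complex.I • v j) := by
  simp [gradForm]

lemma gradForm_single (v : Fin n → A) (j : Fin n) :
    gradForm v (EuclideanSpace.single j 1) = Complex.I • v j := by
  rw [gradForm_apply, Finset.sum_eq_single j] <;> simp +contextual

lemma clm_ext_single {L L' : Rn n →L[ℝ] A}
    (h : ∀ j, L (EuclideanSpace.single j 1) = L' (EuclideanSpace.single j 1)) : L = L' := by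
  apply ContinuousLinearMap.coe_injective
  refine (EuclideanSpace.basisFun (Fin n) ℝ).toBasis.ext fun j => ?_
  simpa using h j

lemma norm_gradForm_le (v : Fin n → A) : ‖gradForm v‖ ≤ ∑ j, ‖v j‖ := by
  refine ContinuousLinearMap.opNorm_le_bound _ (by positivity) fun s => ?_
  rw [gradForm_apply, Finset.sum_mul]
  refine (norm_sum_le _ _).trans (Finset.sum_le_sum fun j _ => ?_)
  rw [norm_smul, norm_smul, Complex.norm_I, one_mul, mul_comm]
  exact mul_le_mul_of_nonneg_left (PiLp.norm_apply_le s j) (norm_nonneg _)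

lemma gradForm_add (v v' : Fin n → A) : gradForm (v + v') = gradForm v + gradForm v' :=
  clm_ext_single fun j => by simp [gradForm_single]

lemma gradForm_sub (v v' : Fin n → A) : gradForm (v - v') = gradForm v - gradForm v' :=
  clm_ext_single fun j => by simp [gradForm_single, smul_sub]

lemma gradForm_smul (c : ℂ) (v : Fin n → A) : gradForm (c • v) = c • gradForm v :=
  clm_ext_single fun j => by simp [gradForm_single, smul_comm c]

/-- The graph of the gradient `u ↦ (δ_1 u, …, δ_n u)`, as a complex subspace. -/
def gradGraph : Submodule ℂ (A × (Fin n → A)) where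
  carrier := {p | HasFDerivAt (𝕜 := ℝ) (fun s => αa s p.1) (gradForm p.2) 0}
  add_mem' {p q} hp hq := by
    have := HasFDerivAt.add hp hq
    change HasFDerivAt (fun s => αa s (p.1 + q.1)) (gradForm (p.2 + q.2)) 0
    simp only [gradForm_add, map_add]
    exact this
  zero_mem' := by
    have : gradForm (0 : Fin n → A) = 0 := clm_ext_single fun j => by
      simp [gradForm_single]
    simpa [this] using hasFDerivAt_const (𝕜 := ℝ) (0 : A) (0 : Rn n)
  smul_mem' c p hp := by
    have := HasFDerivAt.const_smul (R := ℂ) hp c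
    change HasFDerivAt (fun s => αa s (c • p.1)) (gradForm (c • p.2)) 0
    simp only [gradForm_smul, map_smul]
    exact this

lemma mem_gradGraph {p : A × (Fin n → A)} : p ∈ gradGraph αa ↔
    HasFDerivAt (𝕜 := ℝ) (fun s => αa s p.1) (gradForm p.2) 0 := Iff.rfl

variable {αa}

lemma δd_of_mem_gradGraph {u : A} {v : Fin n → A} (h : (u, v) ∈ gradGraph αa) (j : Fin n) :
    δd αa j u = v j := by
  rw [δd, ((mem_gradGraph αa).1 h).fderiv, gradForm_single, smul_smul]
  simp

lemma hasFDerivAt_action (hαadd : ∀ s t (u : A), αa (s + t) u = αa s (αa t u))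
    (hαiso : ∀ s (u : A), ‖αa s u‖ = ‖u‖) {u : A} {L : Rn n →L[ℝ] A}
    (h : HasFDerivAt (fun s => αa s u) L 0) (s : Rn n) :
    HasFDerivAt (fun s => αa s u) ((actionCLM αa hαiso s).comp L) s := by
  have h1 : HasFDerivAt (fun t : Rn n => αa s (αa t u)) ((actionCLM αa hαiso s).comp L) 0 :=
    (actionCLM αa hαiso s).hasFDerivAt.comp (0 : Rn n) h
  have h2 : (fun t : Rn n => αa t u) = (fun t => αa s (αa t u)) ∘ fun t => t - s := by
    funext t
    simp [← hαadd]
  rw [h2]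
  have h3 : HasFDerivAt (fun t : Rn n => t - s) (ContinuousLinearMap.id ℝ (Rn n)) s :=
    (hasFDerivAt_id s).sub_const s
  rw [← sub_self s] at h1
  simpa using HasFDerivAt.comp (f := fun t : Rn n => t - s) s h1 h3

lemma isClosed_gradGraph (hαadd : ∀ s t (u : A), αa (s + t) u = αa s (αa t u))
    (hαiso : ∀ s (u : A), ‖αa s u‖ = ‖u‖) :
    IsClosed (gradGraph αa : Set (A × (Fin n → A))) := by
  refine IsSeqClosed.isClosed fun p q hp hpq => ?_
  have hp1 : Tendsto (fun k => (p k).1) atTop (𝓝 q.1) := (continuous_fst.tendsto q).comp hpq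
  have hp2 : Tendsto (fun k => (p k).2) atTop (𝓝 q.2) := (continuous_snd.tendsto q).comp hpq
  have key := hasFDerivAt_of_tendstoUniformly (𝕜 := ℝ) (l := atTop)
    (f := fun k s => αa s (p k).1)
    (f' := fun k s => (actionCLM αa hαiso s).comp (gradForm (p k).2))
    (g := fun s => αa s q.1)
    (g' := fun s => (actionCLM αa hαiso s).comp (gradForm q.2))
    ?_ (fun k s => hasFDerivAt_action hαadd hαiso (hp k) s) ?_ 0
  · have h0 : (actionCLM αa hαiso 0).comp (gradForm q.2) = gradForm q.2 := by
      have : ∀ u, αa 0 u = u := fun u => by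
        have h := hαadd 0 0 u
        rw [add_zero] at h
        exact ((αa 0).injective h).symm
      ext s
      exact this _
    rw [h0] at key
    exact key
  · rw [Metric.tendstoUniformly_iff]
    intro ε hε
    have hsum : Tendsto (fun k => ∑ j, ‖(q.2 - (p k).2) j‖) atTop (𝓝 0) := by
      have : Tendsto (fun k => ∑ j, ‖(q.2 - (p k).2) j‖) atTop
          (𝓝 (∑ j, ‖(q.2 - q.2) j‖)) :=
        tendsto_finsetSum _ fun j _ =>
          (((tendsto_const_nhds.sub hp2).apply_nhds j)).norm
      simpa using this
    filter_upwards [hsum.eventually (gt_mem_nhds hε)] with k hk s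
    rw [dist_eq_norm, ← ContinuousLinearMap.comp_sub, ← gradForm_sub]
    refine lt_of_le_of_lt ?_ hk
    refine le_trans ?_ (norm_gradForm_le _)
    refine (ContinuousLinearMap.opNorm_comp_le _ _).trans ?_
    refine mul_le_of_le_one_left (norm_nonneg _) ?_
    exact LinearMap.mkContinuous_norm_le _ zero_le_one _
  · intro s
    exact ((actionCLM αa hαiso s).continuous.tendsto _).comp hp1

end Action

section Smooth

variable {αa : Rn n → (A ≃⋆ₐ[ℂ] A)}

lemma grad_mem_gradGraph {u : A} (hu : u ∈ SmoothSet αa) :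
    (u, fun j => δd αa j u) ∈ gradGraph αa := by
  have hd : DifferentiableAt ℝ (fun s => αa s u) 0 :=
    ((hu 1).differentiable (by norm_num)).differentiableAt
  have : gradForm (fun j => δd αa j u) = fderiv ℝ (fun s => αa s u) 0 :=
    clm_ext_single fun j => by
      rw [gradForm_single, δd, smul_smul]
      simp
  rw [mem_gradGraph, this]
  exact hd.hasFDerivAt

lemma action_δd (hαadd : ∀ s t (u : A), αa (s + t) u = αa s (αa t u))
    (hαiso : ∀ s (u : A), ‖αa s u‖ = ‖u‖) {u : A} (hu : u ∈ SmoothSet αa) (j : Fin n)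
    (s : Rn n) :
    αa s (δd αa j u) =
      (-Complex.I) • fderiv ℝ (fun s => αa s u) s (EuclideanSpace.single j 1) := by
  rw [(hasFDerivAt_action hαadd hαiso (grad_mem_gradGraph hu) s).fderiv]
  change _ = (-Complex.I) • αa s (gradForm (fun j => δd αa j u) (EuclideanSpace.single j 1))
  rw [gradForm_single, map_smul, smul_smul]
  simp

lemma δd_mem_smoothSet (hαadd : ∀ s t (u : A), αa (s + t) u = αa s (αa t u))
    (hαiso : ∀ s (u : A), ‖αa s u‖ = ‖u‖) (j : Fin n) (u : A) (hu : u ∈ SmoothSet αa) :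
    δd αa j u ∈ SmoothSet αa := by
  intro N
  simp only [action_δd hαadd hαiso hu j]
  have h := (hu (N + 1)).fderiv_right (m := N) (by norm_cast)
  exact (h.clm_apply contDiff_const).const_smul (-Complex.I)

lemma δd_comm (hαadd : ∀ s t (u : A), αa (s + t) u = αa s (αa t u))
    (hαiso : ∀ s (u : A), ‖αa s u‖ = ‖u‖) (i j : Fin n) (u : A) (hu : u ∈ SmoothSet αa) :
    δd αa i (δd αa j u) = δd αa j (δd αa i u) := by
  have hd : DifferentiableAt ℝ (fderiv ℝ (fun s => αa s u)) 0 :=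
    ((hu 2).fderiv_right (m := 1) (by norm_num)).differentiable (by norm_num) 0
  have key : ∀ i j : Fin n, δd αa i (δd αa j u) = (-Complex.I) • (-Complex.I) •
      fderiv ℝ (fderiv ℝ (fun s => αa s u)) 0 (EuclideanSpace.single i 1)
        (EuclideanSpace.single j 1) := by
    intro i j
    rw [δd]
    simp only [action_δd hαadd hαiso hu j]
    have h1 := (hd.hasFDerivAt.clm_apply
      (hasFDerivAt_const (EuclideanSpace.single j (1 : ℝ) : Rn n) (0 : Rn n))).const_smul
        (R := ℂ) (-Complex.I)
    have h2 := h1.fderiv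
    congr 1
    refine (congrArg (fun L => L (EuclideanSpace.single i 1)) h2).trans ?_
    simp
  rw [key, key]
  have hsymm : IsSymmSndFDerivAt ℝ (fun s => αa s u) 0 :=
    (hu 2).contDiffAt.isSymmSndFDerivAt (by simp)
  rw [hsymm.eq]

lemma subset_smoothSet (hαadd : ∀ s t (u : A), αa (s + t) u = αa s (αa t u))
    (hαiso : ∀ s (u : A), ‖αa s u‖ = ‖u‖) {S : Set A}
    (hS : ∀ u ∈ S, ∃ v : Fin n → A, (u, v) ∈ gradGraph αa ∧ ∀ j, v j ∈ S) :
    S ⊆ SmoothSet αa := by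
  intro u hu N
  induction N generalizing u with
  | zero =>
    obtain ⟨v, hv, -⟩ := hS u hu
    exact contDiff_zero.2 (continuous_iff_continuousAt.2 fun s =>
      (hasFDerivAt_action hαadd hαiso hv s).continuousAt)
  | succ N ih =>
    obtain ⟨v, hv, hvS⟩ := hS u hu
    have hF := hasFDerivAt_action hαadd hαiso hv
    rw [Nat.cast_add, Nat.cast_one, contDiff_succ_iff_fderiv]
    refine ⟨fun s => (hF s).differentiableAt, by simp, ?_⟩
    have : fderiv ℝ (fun s => αa s u) = fun s => gradForm fun j => αa s (v j) := by
      funext s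
      rw [(hF s).fderiv]
      refine clm_ext_single fun j => ?_
      rw [gradForm_single]
      change αa s (gradForm v (EuclideanSpace.single j 1)) = _
      rw [gradForm_single, map_smul]
    rw [this]
    unfold gradForm
    refine ContDiff.sum fun j _ => ?_
    exact (ContinuousLinearMap.smulRightL ℝ (Rn n) A
      (EuclideanSpace.proj j : Rn n →L[ℝ] ℝ)).contDiff.comp ((ih (hvS j)).const_smul Complex.I)

lemma sub_mem_smoothSet {u v : A} (hu : u ∈ SmoothSet αa) (hv : v ∈ SmoothSet αa) :
    u - v ∈ SmoothSet αa := fun N => by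
  simpa using (hu N).sub (hv N)

lemma δd_sub {u v : A} (hu : u ∈ SmoothSet αa) (hv : v ∈ SmoothSet αa) (j : Fin n) :
    δd αa j (u - v) = δd αa j u - δd αa j v :=
  δd_of_mem_gradGraph (v := fun j => δd αa j u - δd αa j v)
    ((gradGraph αa).sub_mem (grad_mem_gradGraph hu) (grad_mem_gradGraph hv)) j

lemma δword_mem_smoothSet (hαadd : ∀ s t (u : A), αa (s + t) u = αa s (αa t u))
    (hαiso : ∀ s (u : A), ‖αa s u‖ = ‖u‖) (w : List (Fin n)) {u : A} (hu : u ∈ SmoothSet αa) :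
    applyWord (δd αa) w u ∈ SmoothSet αa :=
  applyWord_mem (δd_mem_smoothSet hαadd hαiso) w hu

lemma δword_sub (hαadd : ∀ s t (u : A), αa (s + t) u = αa s (αa t u))
    (hαiso : ∀ s (u : A), ‖αa s u‖ = ‖u‖) (w : List (Fin n)) {u v : A}
    (hu : u ∈ SmoothSet αa) (hv : v ∈ SmoothSet αa) :
    applyWord (δd αa) w (u - v) = applyWord (δd αa) w u - applyWord (δd αa) w v := by
  induction w with
  | nil => rfl
  | cons j w ih =>
    rw [applyWord_cons, ih, δd_sub (δword_mem_smoothSet hαadd hαiso w hu)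
      (δword_mem_smoothSet hαadd hαiso w hv)]
    rfl

lemma δpow_eq_applyWord (b : Fin n → ℕ) (u : A) :
    δpow αa b u = applyWord (δd αa) (multiWord b) u :=
  compList_eq_applyWord _ _ _

lemma δword_eq_δpow (hαadd : ∀ s t (u : A), αa (s + t) u = αa s (αa t u))
    (hαiso : ∀ s (u : A), ‖αa s u‖ = ‖u‖) (w : List (Fin n)) {u : A} (hu : u ∈ SmoothSet αa) :
    applyWord (δd αa) w u = δpow αa (fun j => w.count j) u :=
  applyWord_eq_compList (δd_mem_smoothSet hαadd hαiso)
    (fun i j x hx => δd_comm hαadd hαiso i j x hx) w hu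

end Smooth

/-! ### Smooth maps -/

/-- The maps `ℝⁿ → A` that are of class `C^N` for all `N`. -/
def SmoothMaps (n : ℕ) (A : Type) [NormedRing A] [NormedAlgebra ℂ A] : Set (Rn n → A) :=
  {f | ∀ N : ℕ, ContDiff ℝ N f}

lemma SmoothMaps.hasFDerivAt {f : Rn n → A} (hf : f ∈ SmoothMaps n A) (ξ : Rn n) :
    HasFDerivAt f (fderiv ℝ f ξ) ξ :=
  ((hf 1).differentiable (by norm_num) ξ).hasFDerivAt

lemma pd_mem_smoothMaps (j : Fin n) (f : Rn n → A) (hf : f ∈ SmoothMaps n A) :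
    pd j f ∈ SmoothMaps n A := fun N =>
  ((hf (N + 1)).fderiv_right (m := N) (by norm_cast)).clm_apply contDiff_const

lemma pd_comm (i j : Fin n) (f : Rn n → A) (hf : f ∈ SmoothMaps n A) :
    pd i (pd j f) = pd j (pd i f) := by
  funext ξ
  have hd : DifferentiableAt ℝ (fderiv ℝ f) ξ :=
    ((hf 2).fderiv_right (m := 1) (by norm_num)).differentiable (by norm_num) ξ
  have key : ∀ i j : Fin n, pd i (pd j f) ξ =
      fderiv ℝ (fderiv ℝ f) ξ (EuclideanSpace.single i 1) (EuclideanSpace.single j 1) := by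
    intro i j
    have h1 := hd.hasFDerivAt.clm_apply
      (hasFDerivAt_const (EuclideanSpace.single j (1 : ℝ) : Rn n) ξ)
    refine (congrArg (fun L => L (EuclideanSpace.single i 1)) h1.fderiv).trans ?_
    simp
  rw [key, key]
  have hsymm : IsSymmSndFDerivAt ℝ f ξ := (hf 2).contDiffAt.isSymmSndFDerivAt (by simp)
  rw [hsymm.eq]

lemma pdPow_eq_applyWord (b : Fin n → ℕ) (f : Rn n → A) :
    pdPow b f = applyWord pd (multiWord b) f :=
  compList_eq_applyWord _ _ _

lemma pdWord_eq_pdPow (w : List (Fin n)) {f : Rn n → A} (hf : f ∈ SmoothMaps n A) :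
    applyWord pd w f = pdPow (fun j => w.count j) f :=
  applyWord_eq_compList pd_mem_smoothMaps pd_comm w hf

lemma zdiffPow_eq_applyWord (b : Fin n → ℕ) (r : (Fin n → ℤ) → A) :
    zdiffPow b r = applyWord zdiff (multiWord b) r :=
  compList_eq_applyWord _ _ _

/-- Smooth maps from `ℝⁿ` to the smooth vectors: `ξ ↦ δ^w(f ξ)` is `C^∞` for all words `w`. -/
def SmoothFam (αa : Rn n → (A ≃⋆ₐ[ℂ] A)) : Set (Rn n → A) :=
  {f | (∀ ξ, f ξ ∈ SmoothSet αa) ∧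
    ∀ w : List (Fin n), (fun ξ => applyWord (δd αa) w (f ξ)) ∈ SmoothMaps n A}

section Fam

variable {αa : Rn n → (A ≃⋆ₐ[ℂ] A)}

lemma SmoothFam.smoothMaps {f : Rn n → A} (hf : f ∈ SmoothFam αa) : f ∈ SmoothMaps n A :=
  hf.2 []

lemma δd_comp_mem_smoothFam (hαadd : ∀ s t (u : A), αa (s + t) u = αa s (αa t u))
    (hαiso : ∀ s (u : A), ‖αa s u‖ = ‖u‖) (k : Fin n) (f : Rn n → A) (hf : f ∈ SmoothFam αa) :
    (fun ξ => δd αa k (f ξ)) ∈ SmoothFam αa := by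
  refine ⟨fun ξ => δd_mem_smoothSet hαadd hαiso k _ (hf.1 ξ), fun w => ?_⟩
  simpa [applyWord_append] using hf.2 (w ++ [k])

lemma pd_mem_gradGraph (hαadd : ∀ s t (u : A), αa (s + t) u = αa s (αa t u))
    (hαiso : ∀ s (u : A), ‖αa s u‖ = ‖u‖) (j : Fin n) {f : Rn n → A} (hf : f ∈ SmoothFam αa)
    (ξ : Rn n) :
    (pd j f ξ, fun k => pd j (fun ξ => δd αa k (f ξ)) ξ) ∈ gradGraph αa := by
  have hline : ∀ {g : Rn n → A}, g ∈ SmoothMaps n A →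
      HasDerivAt (fun t : ℝ => g (ξ + t • EuclideanSpace.single j 1)) (pd j g ξ) 0 := by
    intro g hg
    exact (SmoothMaps.hasFDerivAt hg ξ).hasLineDerivAt _
  have hH : HasDerivAt (fun t : ℝ => ((f (ξ + t • EuclideanSpace.single j 1),
      fun k => δd αa k (f (ξ + t • EuclideanSpace.single j 1))) : A × (Fin n → A)))
      (pd j f ξ, fun k => pd j (fun ξ => δd αa k (f ξ)) ξ) 0 :=
    (hline (SmoothFam.smoothMaps hf)).prodMk (hasDerivAt_pi.2 fun k =>
      hline (SmoothFam.smoothMaps (δd_comp_mem_smoothFam hαadd hαiso k f hf)))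
  refine (isClosed_gradGraph hαadd hαiso).mem_of_tendsto hH.tendsto_slope
    (Eventually.of_forall fun t => ?_)
  rw [slope_def_module]
  have hmem : ∀ t : ℝ, ((f (ξ + t • EuclideanSpace.single j 1),
      fun k => δd αa k (f (ξ + t • EuclideanSpace.single j 1))) : A × (Fin n → A)) ∈
      gradGraph αa := fun t => grad_mem_gradGraph (hf.1 _)
  exact ((gradGraph αa).restrictScalars ℝ).smul_mem _ ((gradGraph αa).sub_mem (hmem t) (hmem 0))

lemma δd_pd (hαadd : ∀ s t (u : A), αa (s + t) u = αa s (αa t u))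
    (hαiso : ∀ s (u : A), ‖αa s u‖ = ‖u‖) (j k : Fin n) {f : Rn n → A} (hf : f ∈ SmoothFam αa)
    (ξ : Rn n) : δd αa k (pd j f ξ) = pd j (fun ξ => δd αa k (f ξ)) ξ :=
  δd_of_mem_gradGraph (pd_mem_gradGraph hαadd hαiso j hf ξ) k

lemma δword_comp_mem_smoothFam (hαadd : ∀ s t (u : A), αa (s + t) u = αa s (αa t u))
    (hαiso : ∀ s (u : A), ‖αa s u‖ = ‖u‖) (w : List (Fin n)) {f : Rn n → A}
    (hf : f ∈ SmoothFam αa) : (fun ξ => applyWord (δd αa) w (f ξ)) ∈ SmoothFam αa := by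
  induction w with
  | nil => exact hf
  | cons j w ih => exact δd_comp_mem_smoothFam hαadd hαiso j _ ih

lemma δword_pd (hαadd : ∀ s t (u : A), αa (s + t) u = αa s (αa t u))
    (hαiso : ∀ s (u : A), ‖αa s u‖ = ‖u‖) (w : List (Fin n)) (j : Fin n) {f : Rn n → A}
    (hf : f ∈ SmoothFam αa) :
    (fun ξ => applyWord (δd αa) w (pd j f ξ)) = pd j fun ξ => applyWord (δd αa) w (f ξ) := by
  induction w with
  | nil => rfl
  | cons k w ih =>
    funext ξ
    simp only [applyWord_cons]
    rw [← δd_pd hαadd hαiso j k (δword_comp_mem_smoothFam hαadd hαiso w hf), ← ih]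

lemma pd_mem_smoothFam (hαadd : ∀ s t (u : A), αa (s + t) u = αa s (αa t u))
    (hαiso : ∀ s (u : A), ‖αa s u‖ = ‖u‖) (j : Fin n) (f : Rn n → A) (hf : f ∈ SmoothFam αa) :
    pd j f ∈ SmoothFam αa := by
  refine ⟨fun ξ => ?_, fun w => ?_⟩
  · refine subset_smoothSet hαadd hαiso (S := {u | ∃ g ∈ SmoothFam αa, u = pd j g ξ}) ?_
      ⟨f, hf, rfl⟩
    rintro _ ⟨g, hg, rfl⟩
    exact ⟨_, pd_mem_gradGraph hαadd hαiso j hg ξ, fun k =>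
      ⟨_, δd_comp_mem_smoothFam hαadd hαiso k g hg, rfl⟩⟩
  · rw [δword_pd hαadd hαiso w j hf]
    exact pd_mem_smoothMaps j _ (hf.2 w)

lemma δword_pdWord (hαadd : ∀ s t (u : A), αa (s + t) u = αa s (αa t u))
    (hαiso : ∀ s (u : A), ‖αa s u‖ = ‖u‖) (w v : List (Fin n)) {f : Rn n → A}
    (hf : f ∈ SmoothFam αa) (ξ : Rn n) :
    applyWord (δd αa) w (applyWord pd v f ξ) =
      applyWord pd v (fun ξ => applyWord (δd αa) w (f ξ)) ξ := by
  have := applyWord_rel (S := pd) (P := pd)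
    (R := fun g h : Rn n → A => g ∈ SmoothFam αa ∧ h = fun ξ => applyWord (δd αa) w (g ξ))
    (fun j g h hgh => ⟨pd_mem_smoothFam hαadd hαiso j g hgh.1, by
      rw [hgh.2, δword_pd hαadd hαiso w j hgh.1]⟩) v (x := f) ⟨hf, rfl⟩
  exact (congrFun this.2 ξ).symm

/-- Symbols described through words instead of multi-orders. -/
lemma isSymbol_iff (hαadd : ∀ s t (u : A), αa (s + t) u = αa s (αa t u))
    (hαiso : ∀ s (u : A), ‖αa s u‖ = ‖u‖) {m : ℝ} {ρ : Rn n → A} :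
    IsSymbol αa m ρ ↔ ρ ∈ SmoothFam αa ∧ ∀ a b : Fin n → ℕ, ∃ C > 0, ∀ ξ,
      ‖pdPow b (fun ξ => δpow αa a (ρ ξ)) ξ‖ ≤ C * (1 + ‖ξ‖) ^ (m - (mdeg b : ℝ)) := by
  have key : ρ ∈ SmoothFam αa ↔ (∀ ξ, ρ ξ ∈ SmoothSet αa) ∧
      ∀ a : Fin n → ℕ, ∀ N : ℕ, ContDiff ℝ N fun ξ => δpow αa a (ρ ξ) := by
    refine and_congr_right fun h => ⟨fun hw a => ?_, fun ha w => ?_⟩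
    · simp only [δpow_eq_applyWord]
      exact hw (multiWord a)
    · simp only [δword_eq_δpow hαadd hαiso w (h _)]
      exact ha fun j => w.count j
  rw [IsSymbol, ← and_assoc, ← key]
  refine and_congr_right fun h => ?_
  simp only [pdPow_eq_applyWord, δpow_eq_applyWord, δword_pdWord hαadd hαiso _ _ h]

end Fam

/-! ### Growth of maps on `ℝⁿ` -/

lemma norm_le_sum_abs (x : Rn n) : ‖x‖ ≤ ∑ j, |x j| := by
  have h : x = ∑ j, x j • EuclideanSpace.single j (1 : ℝ) := by
    ext i
    simp [Finset.sum_apply, Pi.single_apply]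
  calc ‖x‖ = ‖∑ j, x j • EuclideanSpace.single j (1 : ℝ)‖ := by rw [← h]
    _ ≤ ∑ j, ‖x j • EuclideanSpace.single j (1 : ℝ)‖ := norm_sum_le _ _
    _ = ∑ j, |x j| := by simp [norm_smul]

/-- The lattice point below `ξ`. -/
def latticeFloor (ξ : Rn n) : Fin n → ℤ := fun j => ⌊ξ j⌋

@[simp] lemma zEmb_apply (k : Fin n → ℤ) (j : Fin n) : zEmb k j = k j := rfl

lemma norm_sub_latticeFloor (ξ : Rn n) : ‖ξ - zEmb (latticeFloor ξ)‖ ≤ n := by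
  refine (norm_le_sum_abs _).trans ?_
  calc ∑ j, |(ξ - zEmb (latticeFloor ξ)) j| ≤ ∑ _j : Fin n, (1 : ℝ) :=
        Finset.sum_le_sum fun j _ => by
          simp only [PiLp.sub_apply, zEmb_apply, latticeFloor, Int.self_sub_floor]
          rw [abs_of_nonneg (Int.fract_nonneg _)]
          exact (Int.fract_lt_one _).le
    _ = n := by simp

lemma zEmb_add (k l : Fin n → ℤ) : zEmb (k + l) = zEmb k + zEmb l := by
  ext j
  simp

lemma zEmb_sub (k l : Fin n → ℤ) : zEmb (k - l) = zEmb k - zEmb l := by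
  ext j
  simp

lemma zEmb_single (j : Fin n) : zEmb (Pi.single j 1) = EuclideanSpace.single j 1 := by
  ext i
  by_cases h : i = j <;> simp [h]

lemma znorm_eq (k : Fin n → ℤ) : znorm k = ‖zEmb k‖ := by
  simp [znorm, EuclideanSpace.norm_eq]

/-- Peetre's inequality. -/
lemma peetre {E : Type*} [SeminormedAddCommGroup E] (s : ℝ) (x y : E) :
    (1 + ‖x‖) ^ s ≤ (1 + ‖y‖) ^ s * (1 + ‖x - y‖) ^ |s| := by
  have hx : 0 < 1 + ‖x‖ := by positivity
  have hy : 0 < 1 + ‖y‖ := by positivity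
  have hd : 0 < 1 + ‖x - y‖ := by positivity
  have key : ∀ a b : E, 1 + ‖a‖ ≤ (1 + ‖b‖) * (1 + ‖a - b‖) := by
    intro a b
    have : ‖a‖ ≤ ‖b‖ + ‖a - b‖ := by simpa using norm_add_le b (a - b)
    nlinarith [norm_nonneg b, norm_nonneg (a - b)]
  rcases le_total 0 s with hs | hs
  · rw [abs_of_nonneg hs, ← Real.mul_rpow hy.le hd.le]
    exact Real.rpow_le_rpow hx.le (key x y) hs
  · rw [abs_of_nonpos hs, Real.rpow_neg hd.le, ← div_eq_mul_inv, le_div_iff₀ (by positivity),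
      ← Real.mul_rpow hx.le hd.le, norm_sub_rev]
    exact Real.rpow_le_rpow_of_nonpos hy (key y x) hs

/-- `f(ξ) = O((1+|ξ|)^s)`. -/
def HasGrowth (s : ℝ) (f : Rn n → A) : Prop := ∃ C > 0, ∀ ξ, ‖f ξ‖ ≤ C * (1 + ‖ξ‖) ^ s

section Growth

variable {s : ℝ} {f g : Rn n → A}

lemma HasGrowth.add (hf : HasGrowth s f) (hg : HasGrowth s g) : HasGrowth s (f + g) := by
  obtain ⟨C, hC, h⟩ := hf
  obtain ⟨C', hC', h'⟩ := hg
  refine ⟨C + C', by positivity, fun ξ => (norm_add_le _ _).trans ?_⟩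
  rw [add_mul]
  exact add_le_add (h ξ) (h' ξ)

lemma HasGrowth.neg (hf : HasGrowth s f) : HasGrowth s (-f) := by
  obtain ⟨C, hC, h⟩ := hf
  exact ⟨C, hC, fun ξ => by simpa using h ξ⟩

lemma HasGrowth.sub (hf : HasGrowth s f) (hg : HasGrowth s g) : HasGrowth s (f - g) := by
  rw [sub_eq_add_neg]
  exact hf.add hg.neg

lemma HasGrowth.mono {s' : ℝ} (hf : HasGrowth s f) (hs : s ≤ s') : HasGrowth s' f := by
  obtain ⟨C, hC, h⟩ := hf
  refine ⟨C, hC, fun ξ => (h ξ).trans ?_⟩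
  gcongr
  linarith [norm_nonneg ξ]

lemma norm_clm_le_sum (L : Rn n →L[ℝ] A) : ‖L‖ ≤ ∑ j, ‖L (EuclideanSpace.single j 1)‖ := by
  have h : L = gradForm fun j => (-Complex.I) • L (EuclideanSpace.single j 1) :=
    clm_ext_single fun j => by
      rw [gradForm_single, smul_smul]
      simp
  have := norm_gradForm_le fun j => (-Complex.I) • L (EuclideanSpace.single j 1)
  rw [← h] at this
  simpa [norm_smul] using this

lemma exists_norm_sub_le (hg : g ∈ SmoothMaps n A) (h : ∀ j, HasGrowth s (pd j g)) {R : ℝ}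
    (hR : 0 ≤ R) :
    ∃ C > 0, ∀ ξ v : Rn n, ‖v‖ ≤ R → ‖g (ξ + v) - g ξ‖ ≤ C * (1 + ‖ξ‖) ^ s := by
  choose C hC hb using h
  refine ⟨(∑ j, C j + 1) * (1 + R) ^ |s| * (R + 1), ?_, fun ξ v hv => ?_⟩
  · have : 0 ≤ ∑ j, C j := Finset.sum_nonneg fun j _ => (hC j).le
    positivity
  have hbound : ∀ x ∈ Metric.closedBall ξ R,
      ‖fderiv ℝ g x‖ ≤ (∑ j, C j + 1) * ((1 + ‖ξ‖) ^ s * (1 + R) ^ |s|) := by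
    intro x hx
    have hp : (1 + ‖x‖) ^ s ≤ (1 + ‖ξ‖) ^ s * (1 + R) ^ |s| := by
      refine (peetre s x ξ).trans ?_
      rw [Metric.mem_closedBall, dist_eq_norm] at hx
      gcongr
    calc ‖fderiv ℝ g x‖ ≤ ∑ j, ‖pd j g x‖ := norm_clm_le_sum _
      _ ≤ ∑ j, C j * ((1 + ‖ξ‖) ^ s * (1 + R) ^ |s|) :=
          Finset.sum_le_sum fun j _ =>
            (hb j x).trans (mul_le_mul_of_nonneg_left hp (hC j).le)
      _ = (∑ j, C j) * ((1 + ‖ξ‖) ^ s * (1 + R) ^ |s|) := by rw [Finset.sum_mul]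
      _ ≤ _ := by gcongr; linarith
  have := (convex_closedBall ξ R).norm_image_sub_le_of_norm_fderiv_le
    (fun x _ => (SmoothMaps.hasFDerivAt hg x).differentiableAt) hbound
    (Metric.mem_closedBall_self hR) (y := ξ + v) (by simpa [dist_eq_norm] using hv)
  refine this.trans ?_
  rw [add_sub_cancel_left]
  have hvR : ‖v‖ ≤ R + 1 := by linarith
  have : 0 ≤ ∑ j, C j := Finset.sum_nonneg fun j _ => (hC j).le
  calc _ ≤ (∑ j, C j + 1) * ((1 + ‖ξ‖) ^ s * (1 + R) ^ |s|) * (R + 1) := by gcongr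
    _ = _ := by ring

lemma HasGrowth.fdiff (hg : g ∈ SmoothMaps n A) (h : ∀ i, HasGrowth s (pd i g)) (j : Fin n) :
    HasGrowth s (fdiff j g) := by
  obtain ⟨C, hC, hb⟩ := exists_norm_sub_le hg h zero_le_one
  exact ⟨C, hC, fun ξ => hb ξ _ (by simp)⟩

lemma HasGrowth.fdiff_sub_pd (hg : g ∈ SmoothMaps n A) (j : Fin n)
    (h : ∀ i, HasGrowth s (pd i (pd j g))) : HasGrowth s (_root_.fdiff j g - pd j g) := by
  obtain ⟨C, hC, hb⟩ := exists_norm_sub_le (pd_mem_smoothMaps j g hg) h zero_le_one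
  refine ⟨C, hC, fun ξ => ?_⟩
  set e : Rn n := EuclideanSpace.single j 1
  have hderiv : ∀ t : ℝ, HasDerivAt (fun t : ℝ => g (ξ + t • e) - t • pd j g ξ)
      (pd j g (ξ + t • e) - pd j g ξ) t := by
    intro t
    have h1 : HasDerivAt (fun t : ℝ => ξ + t • e) e t := by
      simpa using ((hasDerivAt_id t).smul_const e).const_add ξ
    have h2 := (SmoothMaps.hasFDerivAt hg (ξ + t • e)).comp_hasDerivAt t h1
    have h3 : HasDerivAt (fun t : ℝ => t • pd j g ξ) (pd j g ξ) t := by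
      simpa using (hasDerivAt_id t).smul_const (pd j g ξ)
    exact h2.sub h3
  have := norm_image_sub_le_of_norm_deriv_le_segment_01'
    (f := fun t : ℝ => g (ξ + t • e) - t • pd j g ξ)
    (fun t _ => (hderiv t).hasDerivWithinAt) (C := C * (1 + ‖ξ‖) ^ s) fun t ht => hb ξ _ (by
      rw [norm_smul, Real.norm_eq_abs, abs_of_nonneg ht.1]
      simpa [e] using ht.2.le)
  refine le_of_eq_of_le ?_ this
  simp only [Pi.sub_apply, _root_.fdiff, one_smul, zero_smul, add_zero, sub_zero]
  congr 1
  abel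

lemma fdiff_mem_smoothMaps (j : Fin n) (hg : g ∈ SmoothMaps n A) :
    fdiff j g ∈ SmoothMaps n A := fun N =>
  ((hg N).comp (contDiff_id.add contDiff_const)).sub (hg N)

lemma sub_mem_smoothMaps (hf : f ∈ SmoothMaps n A) (hg : g ∈ SmoothMaps n A) :
    f - g ∈ SmoothMaps n A := fun N => (hf N).sub (hg N)

lemma pd_sub (i : Fin n) (hf : f ∈ SmoothMaps n A) (hg : g ∈ SmoothMaps n A) :
    pd i (f - g) = pd i f - pd i g := by
  funext ξ
  simp [pd, ((SmoothMaps.hasFDerivAt hf ξ).sub (SmoothMaps.hasFDerivAt hg ξ)).fderiv]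

lemma pd_fdiff (i j : Fin n) (hg : g ∈ SmoothMaps n A) :
    pd i (fdiff j g) = fdiff j (pd i g) := by
  funext ξ
  have h1 : HasFDerivAt (fun ξ => g (ξ + EuclideanSpace.single j 1))
      (fderiv ℝ g (ξ + EuclideanSpace.single j 1)) ξ :=
    (hasFDerivAt_comp_add_right _).2 (SmoothMaps.hasFDerivAt hg _)
  have h2 := (h1.sub (SmoothMaps.hasFDerivAt hg ξ)).fderiv
  exact congrArg (fun L => L (EuclideanSpace.single i 1)) h2

lemma pdWord_mem_smoothMaps (w : List (Fin n)) (hg : g ∈ SmoothMaps n A) :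
    applyWord pd w g ∈ SmoothMaps n A :=
  applyWord_mem pd_mem_smoothMaps w hg

lemma pdWord_sub (w : List (Fin n)) (hf : f ∈ SmoothMaps n A) (hg : g ∈ SmoothMaps n A) :
    applyWord pd w (f - g) = applyWord pd w f - applyWord pd w g := by
  induction w with
  | nil => rfl
  | cons i w ih =>
    rw [applyWord_cons, ih, pd_sub i (pdWord_mem_smoothMaps w hf) (pdWord_mem_smoothMaps w hg)]
    rfl

lemma pdWord_fdiff (w : List (Fin n)) (j : Fin n) (hg : g ∈ SmoothMaps n A) :
    applyWord pd w (fdiff j g) = fdiff j (applyWord pd w g) := by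
  induction w with
  | nil => rfl
  | cons i w ih =>
    rw [applyWord_cons, ih, pd_fdiff i j (pdWord_mem_smoothMaps w hg)]
    rfl

lemma pdWord_pd (w : List (Fin n)) (j : Fin n) (hg : g ∈ SmoothMaps n A) :
    applyWord pd w (pd j g) = pd j (applyWord pd w g) := by
  induction w with
  | nil => rfl
  | cons i w ih =>
    rw [applyWord_cons, ih, pd_comm i j _ (pdWord_mem_smoothMaps w hg)]
    rfl

lemma fdiffWord_sub (w : List (Fin n)) (f g : Rn n → A) :
    applyWord fdiff w (f - g) = applyWord fdiff w f - applyWord fdiff w g := by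
  induction w with
  | nil => rfl
  | cons i w ih =>
    rw [applyWord_cons, ih]
    funext ξ
    simp only [fdiff, applyWord_cons, Pi.sub_apply]
    abel

/-- Differences of order `p` are controlled by derivatives of order `p`. -/
lemma HasGrowth.fdiffWord (w : List (Fin n)) (hg : g ∈ SmoothMaps n A)
    (h : ∀ v : List (Fin n), v.length = w.length → HasGrowth s (applyWord pd v g)) :
    HasGrowth s (applyWord _root_.fdiff w g) := by
  induction w using List.reverseRecOn generalizing g with
  | nil => exact h [] rfl
  | append_singleton w j ih =>
    rw [applyWord_append, applyWord_cons, applyWord_nil]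
    refine ih (fdiff_mem_smoothMaps j hg) fun v hv => ?_
    rw [pdWord_fdiff v j hg]
    exact HasGrowth.fdiff (pdWord_mem_smoothMaps v hg) (fun i => h (i :: v) (by simp [hv])) j

/-- Differences of order `p` approximate derivatives of order `p` up to derivatives of order
`p + 1`. -/
lemma HasGrowth.fdiffWord_sub_pdWord (w : List (Fin n)) (hg : g ∈ SmoothMaps n A)
    (h : ∀ v : List (Fin n), v.length = w.length + 1 → HasGrowth s (applyWord pd v g)) :
    HasGrowth s (applyWord _root_.fdiff w g - applyWord pd w g) := by
  induction w using List.reverseRecOn generalizing g with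
  | nil => exact ⟨1, one_pos, fun ξ => by simp; positivity⟩
  | append_singleton w j ih =>
    have hpd := pd_mem_smoothMaps j g hg
    have h1 : HasGrowth s (applyWord _root_.fdiff w (_root_.fdiff j g - pd j g)) := by
      refine HasGrowth.fdiffWord w (sub_mem_smoothMaps (fdiff_mem_smoothMaps j hg) hpd)
        fun v hv => ?_
      rw [pdWord_sub v (fdiff_mem_smoothMaps j hg) hpd, pdWord_fdiff v j hg, pdWord_pd v j hg]
      exact HasGrowth.fdiff_sub_pd (pdWord_mem_smoothMaps v hg) j
        fun i => h (i :: j :: v) (by simp [hv])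
    have h2 := ih hpd fun v hv => by
      rw [pdWord_pd v j hg]
      exact h (j :: v) (by simp [hv])
    have h3 := h1.add h2
    rw [fdiffWord_sub] at h3
    simpa [applyWord_append] using h3

lemma fdiffWord_lattice (hf : ∀ k, f (zEmb k) = 0) (w : List (Fin n)) (k : Fin n → ℤ) :
    applyWord fdiff w f (zEmb k) = 0 := by
  induction w generalizing k with
  | nil => exact hf k
  | cons j w ih =>
    simp only [applyWord_cons, fdiff]
    rw [← zEmb_single, ← zEmb_add, ih, ih, sub_zero]

lemma HasGrowth.pdWord_of_lattice (hf : f ∈ SmoothMaps n A) (h0 : ∀ k, f (zEmb k) = 0) {p : ℕ}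
    (h : ∀ v : List (Fin n), v.length = p + 1 → HasGrowth s (applyWord pd v f))
    (w : List (Fin n)) (hw : w.length = p) : HasGrowth s (applyWord pd w f) := by
  obtain ⟨C₁, hC₁, h₁⟩ := HasGrowth.fdiffWord_sub_pdWord w hf (by rwa [hw])
  obtain ⟨C₂, hC₂, h₂⟩ := exists_norm_sub_le (s := s) (pdWord_mem_smoothMaps w hf)
    (fun j => h (j :: w) (by simp [hw])) (Nat.cast_nonneg n)
  refine ⟨(C₁ + C₂) * (1 + n) ^ |s|, by positivity, fun ξ => ?_⟩
  set k := latticeFloor ξ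
  have hk := norm_sub_latticeFloor ξ
  have h₁' := h₁ (zEmb k)
  have h₂' := h₂ (zEmb k) (ξ - zEmb k) hk
  rw [Pi.sub_apply, fdiffWord_lattice h0, zero_sub, norm_neg] at h₁'
  rw [add_sub_cancel] at h₂'
  have hp : (1 + ‖zEmb k‖) ^ s ≤ (1 + ‖ξ‖) ^ s * (1 + n) ^ |s| := by
    refine (peetre s (zEmb k) ξ).trans ?_
    rw [norm_sub_rev]
    gcongr
  calc ‖applyWord pd w f ξ‖
      = ‖(applyWord pd w f ξ - applyWord pd w f (zEmb k)) + applyWord pd w f (zEmb k)‖ := by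
        rw [sub_add_cancel]
    _ ≤ C₂ * (1 + ‖zEmb k‖) ^ s + C₁ * (1 + ‖zEmb k‖) ^ s :=
        (norm_add_le _ _).trans (add_le_add h₂' h₁')
    _ = (C₁ + C₂) * (1 + ‖zEmb k‖) ^ s := by ring
    _ ≤ (C₁ + C₂) * ((1 + ‖ξ‖) ^ s * (1 + n) ^ |s|) := by gcongr
    _ = _ := by ring

/-- A map vanishing on `ℤⁿ` which satisfies symbol estimates of some order decays rapidly along
with all its derivatives. -/
lemma HasGrowth.of_lattice_zero (hf : f ∈ SmoothMaps n A) (h0 : ∀ k, f (zEmb k) = 0) {m : ℝ}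
    (h : ∀ v : List (Fin n), HasGrowth (m - v.length) (applyWord pd v f)) (s : ℝ)
    (w : List (Fin n)) : HasGrowth s (applyWord pd w f) := by
  obtain ⟨N, hN⟩ := exists_nat_ge (m - s)
  have key : ∀ q p : ℕ, N ≤ p + q →
      ∀ v : List (Fin n), v.length = p → HasGrowth s (applyWord pd v f) := by
    intro q
    induction q with
    | zero =>
      intro p hp v hv
      refine (h v).mono ?_
      have : (N : ℝ) ≤ p := by exact_mod_cast hp
      rw [hv]
      linarith
    | succ q ih =>
      intro p hp
      exact HasGrowth.pdWord_of_lattice hf h0 (ih (p + 1) (by omega))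
  exact key N w.length (by omega) w rfl

end Growth

section Uniqueness

variable {αa : Rn n → (A ≃⋆ₐ[ℂ] A)}

lemma sub_mem_smoothFam (hαadd : ∀ s t (u : A), αa (s + t) u = αa s (αa t u))
    (hαiso : ∀ s (u : A), ‖αa s u‖ = ‖u‖) {f g : Rn n → A} (hf : f ∈ SmoothFam αa)
    (hg : g ∈ SmoothFam αa) : f - g ∈ SmoothFam αa := by
  refine ⟨fun ξ => sub_mem_smoothSet (hf.1 ξ) (hg.1 ξ), fun w => ?_⟩
  simp only [Pi.sub_apply, δword_sub hαadd hαiso w (hf.1 _) (hg.1 _)]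
  exact sub_mem_smoothMaps (hf.2 w) (hg.2 w)

lemma isSchwartzSym_sub (hαadd : ∀ s t (u : A), αa (s + t) u = αa s (αa t u))
    (hαiso : ∀ s (u : A), ‖αa s u‖ = ‖u‖) {m : ℝ} {ρ₁ ρ₂ : Rn n → A} (h₁ : IsSymbol αa m ρ₁)
    (h₂ : IsSymbol αa m ρ₂) (h : ∀ k, ρ₁ (zEmb k) = ρ₂ (zEmb k)) :
    IsSchwartzSym αa (ρ₁ - ρ₂) := by
  intro s
  rw [isSymbol_iff hαadd hαiso] at h₁ h₂ ⊢
  have hfam := sub_mem_smoothFam hαadd hαiso h₁.1 h₂.1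
  refine ⟨hfam, fun a b => ?_⟩
  have hsub : (fun ξ => δpow αa a ((ρ₁ - ρ₂) ξ)) =
      (fun ξ => δpow αa a (ρ₁ ξ)) - fun ξ => δpow αa a (ρ₂ ξ) := by
    funext ξ
    simp only [δpow_eq_applyWord, Pi.sub_apply,
      δword_sub hαadd hαiso _ (h₁.1.1 _) (h₂.1.1 _)]
  have hs₁ : (fun ξ => δpow αa a (ρ₁ ξ)) ∈ SmoothMaps n A := by
    simp only [δpow_eq_applyWord]
    exact h₁.1.2 _
  have hs₂ : (fun ξ => δpow αa a (ρ₂ ξ)) ∈ SmoothMaps n A := by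
    simp only [δpow_eq_applyWord]
    exact h₂.1.2 _
  rw [hsub, pdPow_eq_applyWord]
  refine HasGrowth.of_lattice_zero (sub_mem_smoothMaps hs₁ hs₂) (fun k => ?_) (m := m)
    (fun v => ?_) _ _
  · simp [h k]
  · rw [pdWord_sub v hs₁ hs₂, pdWord_eq_pdPow v hs₁, pdWord_eq_pdPow v hs₂, ← mdeg_count v]
    exact HasGrowth.sub (h₁.2 a _) (h₂.2 a _)

end Uniqueness

/-! ### An interpolation kernel on the line -/

section LineKernel

open scoped FourierTransform SchwartzMap ContDiff

/-- A smooth cut-off supported in `[-3/4, 3/4]` whose translates by `ℤ` sum to `1`. -/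
def unityBump (x : ℝ) : ℝ :=
  Real.smoothTransition (2 * (1 + x) - 1 / 2) * Real.smoothTransition (2 * (1 - x) - 1 / 2)

lemma unityBump_eq_zero {x : ℝ} (hx : 3 / 4 ≤ |x|) : unityBump x = 0 := by
  rw [unityBump]
  rcases le_abs'.1 hx with h | h
  · rw [Real.smoothTransition.zero_of_nonpos (x := 2 * (1 + x) - 1 / 2) (by linarith), zero_mul]
  · rw [Real.smoothTransition.zero_of_nonpos (x := 2 * (1 - x) - 1 / 2) (by linarith), mul_zero]

lemma contDiff_unityBump : ContDiff ℝ ∞ unityBump :=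
  (Real.smoothTransition.contDiff.comp (by fun_prop)).mul
    (Real.smoothTransition.contDiff.comp (by fun_prop))

lemma smoothTransition_add (x : ℝ) :
    Real.smoothTransition x + Real.smoothTransition (1 - x) = 1 := by
  have h := (Real.smoothTransition.pos_denom x).ne'
  rw [Real.smoothTransition, Real.smoothTransition, sub_sub_cancel,
    add_comm (expNegInvGlue (1 - x)), ← add_div, div_self h]

lemma unityBump_add {x : ℝ} (h0 : 0 ≤ x) (h1 : x ≤ 1) :
    unityBump (x - 1) + unityBump x = 1 := by
  have h := smoothTransition_add (2 * (1 + (x - 1)) - 1 / 2)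
  rw [show 1 - (2 * (1 + (x - 1)) - 1 / 2) = 2 * (1 - x) - 1 / 2 by ring] at h
  rw [unityBump, unityBump,
    Real.smoothTransition.one_of_one_le (x := 2 * (1 - (x - 1)) - 1 / 2) (by linarith),
    Real.smoothTransition.one_of_one_le (x := 2 * (1 + x) - 1 / 2) (by linarith), mul_one, one_mul]
  exact h

/-- The entire function `(e^z - 1) / z`. -/
def expQuot : ℂ → ℂ := dslope Complex.exp 0

lemma mul_expQuot (z : ℂ) : z * expQuot z = Complex.exp z - 1 := by
  simpa [expQuot] using sub_smul_dslope Complex.exp 0 z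

lemma contDiff_expQuot : ContDiff ℂ ∞ expQuot := by
  refine Differentiable.contDiff ?_
  rw [← differentiableOn_univ]
  exact (Complex.differentiableOn_dslope Filter.univ_mem).2
    Complex.differentiable_exp.differentiableOn

/-- The phase `-2πix`. -/
def fourierPhase (x : ℝ) : ℂ := -(2 * π * Complex.I * x)

lemma contDiff_fourierPhase : ContDiff ℝ ∞ fourierPhase :=
  (contDiff_const.mul Complex.ofRealCLM.contDiff).neg

lemma expQuot_ne_zero {x : ℝ} (hx : |x| < 1) : expQuot (fourierPhase x) ≠ 0 := by
  rcases eq_or_ne x 0 with rfl | h0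
  · simp [fourierPhase, expQuot]
  intro h
  have h1 := mul_expQuot (fourierPhase x)
  rw [h, mul_zero, eq_comm, sub_eq_zero, Complex.exp_eq_one_iff] at h1
  obtain ⟨k, hk⟩ := h1
  have hk' : (x : ℂ) = ((-k : ℤ) : ℂ) := by
    have hpi : (2 * π * Complex.I : ℂ) ≠ 0 := Complex.two_pi_I_ne_zero
    apply mul_left_cancel₀ hpi
    rw [fourierPhase] at hk
    push_cast
    linear_combination -hk
  have hk'' : x = ((-k : ℤ) : ℝ) := by exact_mod_cast hk'
  rw [hk''] at hx h0
  rw [← Int.cast_abs] at hx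
  have : |(-k : ℤ)| < 1 := by exact_mod_cast hx
  exact h0 (by rw [Int.abs_lt_one_iff.1 this, Int.cast_zero])

/-- The cut-off divided by the `b`-th power of `(e^{-2πix} - 1) / (-2πix)`. -/
def bumpQuot (b : ℕ) (x : ℝ) : ℂ := unityBump x / expQuot (fourierPhase x) ^ b

lemma hasCompactSupport_bumpQuot (b : ℕ) : HasCompactSupport (bumpQuot b) := by
  refine HasCompactSupport.intro (isCompact_Icc (a := (-(3 / 4) : ℝ)) (b := 3 / 4)) fun x hx => ?_
  rw [bumpQuot, unityBump_eq_zero, Complex.ofReal_zero, zero_div]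
  by_contra! h
  exact hx ⟨(abs_lt.1 h).1.le, (abs_lt.1 h).2.le⟩

lemma contDiff_bumpQuot (b : ℕ) : ContDiff ℝ ∞ (bumpQuot b) := by
  rw [contDiff_iff_contDiffAt]
  intro x
  rcases lt_or_ge |x| 1 with hx | hx
  · have h1 : ContDiff ℝ ∞ fun x : ℝ => (unityBump x : ℂ) :=
      Complex.ofRealCLM.contDiff.comp contDiff_unityBump
    have h2 : ContDiff ℝ ∞ fun x : ℝ => expQuot (fourierPhase x) ^ b :=
      ((contDiff_expQuot.restrict_scalars ℝ).comp contDiff_fourierPhase).pow b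
    have h3 : expQuot (fourierPhase x) ^ b ≠ 0 := pow_ne_zero b (expQuot_ne_zero hx)
    have h4 : ContDiffAt ℝ ∞ (fun x : ℝ => (expQuot (fourierPhase x) ^ b)⁻¹) x :=
      h2.contDiffAt.inv h3
    have h5 : bumpQuot b = fun x => (unityBump x : ℂ) * (expQuot (fourierPhase x) ^ b)⁻¹ :=
      funext fun x => div_eq_mul_inv _ _
    rw [h5]
    exact h1.contDiffAt.mul h4
  · refine (contDiffAt_const (c := (0 : ℂ))).congr_of_eventuallyEq ?_
    have hlt : (3 / 4 : ℝ) < |x| := by linarith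
    filter_upwards [(continuous_abs.tendsto x).eventually (lt_mem_nhds hlt)] with y hy
    rw [bumpQuot, unityBump_eq_zero hy.le, Complex.ofReal_zero, zero_div]

/-- `bumpQuot b` as a Schwartz function. -/
def bumpQuotSchwartz (b : ℕ) : 𝓢(ℝ, ℂ) :=
  (hasCompactSupport_bumpQuot b).toSchwartzMap (contDiff_bumpQuot b)

/-- The kernels `φ_b`: `φ_0` interpolates at the integers, and `φ_b'` is the forward difference of
`φ_{b+1}`. -/
def lineKernel (b : ℕ) : 𝓢(ℝ, ℂ) := 𝓕 (bumpQuotSchwartz b)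

lemma lineKernel_apply (b : ℕ) (w : ℝ) :
    lineKernel b w = ∫ x : ℝ, Complex.exp (fourierPhase (x * w)) * bumpQuot b x := by
  rw [lineKernel, SchwartzMap.fourier_coe, Real.fourier_real_eq_integral_exp_smul]
  refine MeasureTheory.integral_congr_ae (Eventually.of_forall fun x => ?_)
  change Complex.exp _ * bumpQuot b x = _
  congr 2
  rw [fourierPhase]
  push_cast
  ring

lemma integrable_bumpQuot (b : ℕ) (w : ℝ) : MeasureTheory.Integrable fun x : ℝ =>
    Complex.exp (fourierPhase (x * w)) * bumpQuot b x := by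
  refine Continuous.integrable_of_hasCompactSupport ?_ (hasCompactSupport_bumpQuot b).mul_left
  refine Continuous.mul ?_ (contDiff_bumpQuot b).continuous
  exact Complex.continuous_exp.comp (contDiff_fourierPhase.continuous.comp (by fun_prop))

lemma fourierPhase_mul_bumpQuot (b : ℕ) (x : ℝ) :
    fourierPhase x * bumpQuot b x =
      (Complex.exp (fourierPhase x) - 1) * bumpQuot (b + 1) x := by
  rw [← mul_expQuot, bumpQuot, bumpQuot]
  rcases lt_or_ge |x| 1 with hx | hx
  · have := expQuot_ne_zero hx
    field_simp
    ring
  · rw [unityBump_eq_zero (by linarith)]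
    simp

lemma hasDerivAt_lineKernel (b : ℕ) (w : ℝ) :
    HasDerivAt (lineKernel b) (lineKernel (b + 1) (w + 1) - lineKernel (b + 1) w) w := by
  have hint : MeasureTheory.Integrable (bumpQuot b) :=
    (contDiff_bumpQuot b).continuous.integrable_of_hasCompactSupport (hasCompactSupport_bumpQuot b)
  have hint' : MeasureTheory.Integrable fun x : ℝ => x • bumpQuot b x :=
    (continuous_id.smul (contDiff_bumpQuot b).continuous).integrable_of_hasCompactSupport
      (hasCompactSupport_bumpQuot b).smul_left
  have h := Real.hasDerivAt_fourier hint hint' w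
  refine HasDerivAt.congr_deriv (f := lineKernel b) h ?_
  symm
  rw [lineKernel_apply, lineKernel_apply, ← MeasureTheory.integral_sub (integrable_bumpQuot _ _)
    (integrable_bumpQuot _ _), Real.fourier_real_eq_integral_exp_smul]
  refine MeasureTheory.integral_congr_ae (Eventually.of_forall fun x => ?_)
  have h1 : fourierPhase (x * (w + 1)) = fourierPhase (x * w) + fourierPhase x := by
    simp only [fourierPhase]
    push_cast
    ring
  have h2 : Complex.exp (((-2 * π * x * w : ℝ) : ℂ) * Complex.I) =
      Complex.exp (fourierPhase (x * w)) := by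
    congr 1
    rw [fourierPhase]
    push_cast
    ring
  have h3 : (-2 * π * Complex.I * x : ℂ) = fourierPhase x := by
    rw [fourierPhase]
    ring
  simp only [smul_eq_mul, h1, h2, h3, Complex.exp_add, fourierPhase_mul_bumpQuot]
  ring

lemma lineKernel_zero_int (l : ℤ) : lineKernel 0 (l : ℝ) = if l = 0 then 1 else 0 := by
  rw [lineKernel_apply]
  set F : ℝ → ℂ := fun x => Complex.exp (fourierPhase (x * l)) * bumpQuot 0 x with hF
  have hcont : Continuous F := by
    refine Continuous.mul ?_ (contDiff_bumpQuot 0).continuous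
    exact Complex.continuous_exp.comp (contDiff_fourierPhase.continuous.comp (by fun_prop))
  have hper : ∀ x : ℝ, Complex.exp (fourierPhase ((x - 1) * l)) =
      Complex.exp (fourierPhase (x * l)) := by
    intro x
    rw [Complex.exp_eq_exp_iff_exists_int]
    refine ⟨l, ?_⟩
    simp only [fourierPhase]
    push_cast
    ring
  have hsupp : Function.support F ⊆ Set.Ioc (-1 : ℝ) 1 := by
    intro x hx
    by_contra hx'
    refine hx ?_
    have : 3 / 4 ≤ |x| := by
      by_contra! h
      have := abs_lt.1 h
      exact hx' ⟨by linarith, by linarith⟩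
    simp [hF, bumpQuot, unityBump_eq_zero this]
  rw [← intervalIntegral.integral_eq_integral_of_support_subset hsupp,
    ← intervalIntegral.integral_add_adjacent_intervals (b := 0)
      (hcont.intervalIntegrable _ _) (hcont.intervalIntegrable _ _)]
  have hshift : ∫ x in (-1 : ℝ)..0, F x = ∫ x in (0 : ℝ)..1, F (x - 1) := by
    rw [intervalIntegral.integral_comp_sub_right]
    norm_num
  have hcont' : Continuous fun x : ℝ => F (x - 1) := hcont.comp (by fun_prop)
  rw [hshift, ← intervalIntegral.integral_add (hcont'.intervalIntegrable _ _)
    (hcont.intervalIntegrable _ _)]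
  have hone : ∫ x in (0 : ℝ)..1, (F (x - 1) + F x) =
      ∫ x in (0 : ℝ)..1, Complex.exp (-(2 * π * Complex.I * l) * x) := by
    refine intervalIntegral.integral_congr fun x hx => ?_
    rw [Set.uIcc_of_le zero_le_one] at hx
    have hb : (unityBump (x - 1) : ℂ) + unityBump x = 1 := by
      exact_mod_cast unityBump_add hx.1 hx.2
    simp only [hF, hper, bumpQuot, pow_zero, div_one]
    rw [← mul_add, hb, mul_one, fourierPhase]
    push_cast
    congr 1
    ring
  rw [hone]
  split_ifs with hl
  · simp [hl]
  · have hc : (-(2 * π * Complex.I * l) : ℂ) ≠ 0 :=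
      neg_ne_zero.2 (mul_ne_zero Complex.two_pi_I_ne_zero (by exact_mod_cast hl))
    rw [integral_exp_mul_complex hc]
    have : Complex.exp (-(2 * π * Complex.I * l) * (1 : ℝ)) = 1 :=
      Complex.exp_eq_one_iff.2 ⟨-l, by push_cast; ring⟩
    rw [this]
    simp

lemma lineKernel_decay (b M : ℕ) : ∃ C > 0, ∀ x : ℝ, ‖lineKernel b x‖ * (1 + |x|) ^ M ≤ C := by
  obtain ⟨C, hC⟩ : ∃ C, ∀ x : ℝ, ‖lineKernel b x‖ * (1 + |x|) ^ M ≤ C := by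
    refine ⟨2 ^ M * (Finset.Iic (M, 0)).sup (fun m => SchwartzMap.seminorm ℝ m.1 m.2)
      (lineKernel b), fun x => ?_⟩
    have h := SchwartzMap.one_add_le_sup_seminorm_apply (𝕜 := ℝ) (m := (M, 0)) (k := M) (n := 0)
      le_rfl le_rfl (lineKernel b) x
    rw [norm_iteratedFDeriv_zero, mul_comm, Real.norm_eq_abs] at h
    exact h
  exact ⟨|C| + 1, by positivity, fun x => (hC x).trans (by linarith [le_abs_self C])⟩

end LineKernel

/-! ### The lattice kernel -/

/-- The tensor product of the kernels `φ_{c_j}`. -/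
def latticeKernel (c : Fin n → ℕ) (x : Rn n) : ℂ := ∏ j, lineKernel (c j) (x j)

lemma one_add_sum_le_prod {ι : Type*} (s : Finset ι) {f : ι → ℝ} (hf : ∀ i, 0 ≤ f i) :
    1 + ∑ i ∈ s, f i ≤ ∏ i ∈ s, (1 + f i) := by
  classical
  induction s using Finset.induction_on with
  | empty => simp
  | insert i s hi ih =>
    rw [Finset.sum_insert hi, Finset.prod_insert hi]
    have h1 := hf i
    have h2 : 0 ≤ ∑ i ∈ s, f i := Finset.sum_nonneg fun i _ => hf i
    nlinarith

lemma one_add_norm_le_prod (x : Rn n) : 1 + ‖x‖ ≤ ∏ j, (1 + |x j|) :=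
  (add_le_add_right (norm_le_sum_abs x) 1).trans (one_add_sum_le_prod _ fun _ => abs_nonneg _)

lemma latticeKernel_decay (c : Fin n → ℕ) (t : ℝ) :
    ∃ C > 0, ∀ x : Rn n, ‖latticeKernel c x‖ ≤ C * (1 + ‖x‖) ^ (-t) := by
  choose C hC h using fun j => lineKernel_decay (c j) ⌈t⌉₊
  refine ⟨∏ j, C j, Finset.prod_pos fun j _ => hC j, fun x => ?_⟩
  have hx : (0 : ℝ) < 1 + ‖x‖ := by positivity
  have h1 : ‖latticeKernel c x‖ * (1 + ‖x‖) ^ ⌈t⌉₊ ≤ ∏ j, C j :=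
    calc ‖latticeKernel c x‖ * (1 + ‖x‖) ^ ⌈t⌉₊
        ≤ (∏ j, ‖lineKernel (c j) (x j)‖) * (∏ j, (1 + |x j|)) ^ ⌈t⌉₊ := by
          rw [latticeKernel, norm_prod]
          gcongr
          exact one_add_norm_le_prod x
      _ = ∏ j, ‖lineKernel (c j) (x j)‖ * (1 + |x j|) ^ ⌈t⌉₊ := by
          rw [← Finset.prod_pow, Finset.prod_mul_distrib]
      _ ≤ ∏ j, C j := Finset.prod_le_prod (fun j _ => by positivity) fun j _ => h j _
  rw [Real.rpow_neg hx.le, ← div_eq_mul_inv, le_div_iff₀ (by positivity)]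
  refine le_trans ?_ h1
  gcongr
  rw [← Real.rpow_natCast]
  exact Real.rpow_le_rpow_of_exponent_le (by linarith [norm_nonneg x]) (Nat.le_ceil t)

lemma latticeKernel_zero (l : Fin n → ℤ) :
    latticeKernel 0 (zEmb l) = if l = 0 then 1 else 0 := by
  simp only [latticeKernel, Pi.zero_apply, zEmb_apply, lineKernel_zero_int]
  split_ifs with h
  · simp [h]
  · obtain ⟨j, hj⟩ := Function.ne_iff.1 h
    exact Finset.prod_eq_zero (Finset.mem_univ j) (if_neg hj)

lemma latticeKernel_sub (c : Fin n → ℕ) (j : Fin n) (x : Rn n) :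
    latticeKernel (c + Pi.single j 1) (x + EuclideanSpace.single j 1) -
      latticeKernel (c + Pi.single j 1) x =
    (∏ i ∈ Finset.univ.erase j, lineKernel (c i) (x i)) *
      (lineKernel (c j + 1) (x j + 1) - lineKernel (c j + 1) (x j)) := by
  simp only [latticeKernel]
  rw [← Finset.prod_erase_mul _ _ (Finset.mem_univ j), ← Finset.prod_erase_mul _ _
    (Finset.mem_univ j), mul_sub]
  congr 1
  · congr 1
    · refine Finset.prod_congr rfl fun i hi => ?_
      simp [Finset.ne_of_mem_erase hi]
    · simp
  · congr 1
    · refine Finset.prod_congr rfl fun i hi => ?_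
      simp [Finset.ne_of_mem_erase hi]
    · simp

/-- The gradient of `latticeKernel c`. -/
def latticeKernelGrad (c : Fin n → ℕ) (x : Rn n) : Rn n →L[ℝ] ℂ :=
  ∑ j, (EuclideanSpace.proj j : Rn n →L[ℝ] ℝ).smulRight
    (latticeKernel (c + Pi.single j 1) (x + EuclideanSpace.single j 1) -
      latticeKernel (c + Pi.single j 1) x)

lemma latticeKernelGrad_single (c : Fin n → ℕ) (x : Rn n) (j : Fin n) :
    latticeKernelGrad c x (EuclideanSpace.single j 1) =
      latticeKernel (c + Pi.single j 1) (x + EuclideanSpace.single j 1) -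
        latticeKernel (c + Pi.single j 1) x := by
  simp only [latticeKernelGrad, _root_.sum_apply,
    ContinuousLinearMap.smulRight_apply]
  rw [Finset.sum_eq_single j] <;> simp +contextual

lemma hasFDerivAt_latticeKernel (c : Fin n → ℕ) (x : Rn n) :
    HasFDerivAt (latticeKernel c) (latticeKernelGrad c x) x := by
  have hcoord : ∀ j, HasFDerivAt (fun x : Rn n => lineKernel (c j) (x j))
      ((EuclideanSpace.proj j : Rn n →L[ℝ] ℝ).smulRight
        (lineKernel (c j + 1) (x j + 1) - lineKernel (c j + 1) (x j))) x := fun j => by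
    have h1 : HasFDerivAt (fun x : Rn n => x j) (EuclideanSpace.proj j : Rn n →L[ℝ] ℝ) x :=
      (EuclideanSpace.proj j : Rn n →L[ℝ] ℝ).hasFDerivAt
    have h2 := (hasDerivAt_lineKernel (c j) (x j)).hasFDerivAt
    refine (HasFDerivAt.comp (f := fun x : Rn n => x j) x h2 h1).congr_fderiv ?_
    ext y
    simp
  have h := HasFDerivAt.finsetProd (𝕜 := ℝ) (u := Finset.univ) (x := x)
    (g := fun (j : Fin n) (x : Rn n) => lineKernel (c j) (x j))
    (g' := fun j => (EuclideanSpace.proj j : Rn n →L[ℝ] ℝ).smulRight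
      (lineKernel (c j + 1) (x j + 1) - lineKernel (c j + 1) (x j))) fun j _ => hcoord j
  refine h.congr_fderiv (Finset.sum_congr rfl fun j _ => ?_)
  rw [latticeKernel_sub]
  ext y
  simp
  ring

/-! ### Lattice sums -/

lemma summable_pi_prod {f : ℤ → ℝ} (h0 : ∀ l, 0 ≤ f l) (hf : Summable f) (n : ℕ) :
    Summable fun k : Fin n → ℤ => ∏ j, f (k j) := by
  induction n with
  | zero => exact Summable.of_finite
  | succ n ih =>
    rw [← (Fin.consEquiv fun _ : Fin (n + 1) => ℤ).summable_iff]
    have := hf.mul_of_nonneg ih h0 fun k => Finset.prod_nonneg fun j _ => h0 _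
    refine this.congr fun p => ?_
    simp [Fin.prod_univ_succ, Fin.consEquiv]

lemma summable_one_add_abs_int : Summable fun l : ℤ => ((1 + |(l : ℝ)|) ^ 2)⁻¹ := by
  have h : Summable fun l : ℕ => ((1 + (l : ℝ)) ^ 2)⁻¹ := by
    have := (summable_nat_add_iff 1).2 (Real.summable_nat_pow_inv (p := 2).2 one_lt_two)
    simpa [add_comm] using this
  refine Summable.of_nat_of_neg ?_ ?_ <;> simpa using h

/-- The weight `(1+|ξ-k|)^{-2n}`. -/
def latticeWeight (ξ : Rn n) (k : Fin n → ℤ) : ℝ := (1 + ‖ξ - zEmb k‖) ^ (-(2 * n : ℝ))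

lemma latticeWeight_le (ξ η : Rn n) (k : Fin n → ℤ) :
    latticeWeight ξ k ≤ latticeWeight η k * (1 + ‖ξ - η‖) ^ (2 * n : ℝ) := by
  have h := peetre (-(2 * n : ℝ)) (ξ - zEmb k) (η - zEmb k)
  rwa [sub_sub_sub_cancel_right, abs_neg, abs_of_nonneg (by positivity)] at h

lemma summable_latticeWeight_zero : Summable (latticeWeight (0 : Rn n)) := by
  refine Summable.of_nonneg_of_le (fun k => by unfold latticeWeight; positivity) (fun k => ?_)
    (summable_pi_prod (fun l => by positivity) summable_one_add_abs_int n)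
  rw [latticeWeight, zero_sub, norm_neg, Real.rpow_neg (by positivity), Finset.prod_inv_distrib]
  refine inv_anti₀ (Finset.prod_pos fun j _ => by positivity) ?_
  calc ∏ j, (1 + |(k j : ℝ)|) ^ 2 ≤ ∏ _j : Fin n, (1 + ‖zEmb k‖) ^ 2 := by
        refine Finset.prod_le_prod (fun j _ => by positivity) fun j _ => ?_
        gcongr
        exact PiLp.norm_apply_le (zEmb k) j
    _ = (1 + ‖zEmb k‖) ^ (2 * n : ℝ) := by
        rw [Finset.prod_const, Finset.card_univ, Fintype.card_fin, ← pow_mul, ← Real.rpow_natCast]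
        norm_cast

lemma exists_tsum_latticeWeight_le (n : ℕ) : ∃ C > 0, ∀ ξ : Rn n,
    Summable (latticeWeight ξ) ∧ ∑' k, latticeWeight ξ k ≤ C := by
  have h0 := summable_latticeWeight_zero (n := n)
  have hnn : ∀ ξ : Rn n, ∀ k, 0 ≤ latticeWeight ξ k := fun ξ k => by
    unfold latticeWeight
    positivity
  have hS : 0 ≤ ∑' k, latticeWeight (0 : Rn n) k := tsum_nonneg (hnn 0)
  set D : ℝ := (1 + n) ^ (2 * n : ℝ) with hD
  have hDpos : 0 < D := by positivity
  refine ⟨(∑' k, latticeWeight (0 : Rn n) k) * D + 1, by positivity, fun ξ => ?_⟩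
  set e := Equiv.subRight (latticeFloor ξ)
  have hle : ∀ k, latticeWeight ξ k ≤ latticeWeight 0 (e k) * D := fun k => by
    have h1 : latticeWeight (zEmb (latticeFloor ξ)) k = latticeWeight 0 (e k) := by
      simp only [latticeWeight, e, Equiv.subRight_apply, zEmb_sub]
      congr 3
      abel
    rw [← h1]
    refine (latticeWeight_le ξ (zEmb (latticeFloor ξ)) k).trans ?_
    refine mul_le_mul_of_nonneg_left ?_ (hnn _ _)
    exact Real.rpow_le_rpow (by positivity) (by linarith [norm_sub_latticeFloor ξ])
      (by positivity)
  have hsum : Summable fun k => latticeWeight 0 (e k) * D := (e.summable_iff.2 h0).mul_right D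
  have hsum' := Summable.of_nonneg_of_le (hnn ξ) hle hsum
  refine ⟨hsum', (hsum'.tsum_le_tsum hle hsum).trans ?_⟩
  rw [tsum_mul_right, e.tsum_eq (latticeWeight 0)]
  linarith

/-! ### Sampling series -/

/-- `r_k = O((1+|k|)^s)`. -/
def SeqGrowth (s : ℝ) (r : (Fin n → ℤ) → A) : Prop := ∃ C > 0, ∀ k, ‖r k‖ ≤ C * (1 + ‖zEmb k‖) ^ s

/-- The sampling series `ξ ↦ ∑ₖ K_c(ξ-k) r_k`. -/
def sampling (c : Fin n → ℕ) (r : (Fin n → ℤ) → A) (ξ : Rn n) : A :=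
  ∑' k, latticeKernel c (ξ - zEmb k) • r k

section Sampling

variable {s : ℝ} {r : (Fin n → ℤ) → A}

lemma SeqGrowth.sub {r' : (Fin n → ℤ) → A} (hr : SeqGrowth s r) (hr' : SeqGrowth s r') :
    SeqGrowth s fun k => r k - r' k := by
  obtain ⟨C, hC, h⟩ := hr
  obtain ⟨C', hC', h'⟩ := hr'
  refine ⟨C + C', by positivity, fun k => (norm_sub_le _ _).trans ?_⟩
  rw [add_mul]
  exact add_le_add (h k) (h' k)

lemma SeqGrowth.shift (hr : SeqGrowth s r) (l : Fin n → ℤ) : SeqGrowth s fun k => r (k + l) := by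
  obtain ⟨C, hC, h⟩ := hr
  refine ⟨C * (1 + ‖zEmb l‖) ^ |s|, by positivity, fun k => (h _).trans ?_⟩
  rw [mul_assoc, mul_comm ((1 + ‖zEmb l‖) ^ |s|)]
  refine mul_le_mul_of_nonneg_left ?_ hC.le
  simpa [← zEmb_sub] using peetre s (zEmb (k + l)) (zEmb k)

lemma SeqGrowth.zdiff (hr : SeqGrowth s r) (j : Fin n) : SeqGrowth s (zdiff j r) :=
  (hr.shift _).sub hr

lemma norm_latticeKernel_smul_le (hr : SeqGrowth s r) (c : Fin n → ℕ) : ∃ C > 0,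
    ∀ (ξ : Rn n) (k), ‖latticeKernel c (ξ - zEmb k) • r k‖ ≤
      C * (1 + ‖ξ‖) ^ s * latticeWeight ξ k := by
  obtain ⟨C, hC, h⟩ := hr
  obtain ⟨C', hC', h'⟩ := latticeKernel_decay c (|s| + 2 * n)
  refine ⟨C' * C, by positivity, fun ξ k => ?_⟩
  have hp := peetre s (zEmb k) ξ
  rw [norm_sub_rev] at hp
  have hpos : 0 < 1 + ‖ξ - zEmb k‖ := by positivity
  have hexp : (1 + ‖ξ - zEmb k‖) ^ (-(|s| + 2 * n)) * (1 + ‖ξ - zEmb k‖) ^ |s| =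
      latticeWeight ξ k := by
    rw [← Real.rpow_add hpos, latticeWeight]
    congr 1
    ring
  rw [norm_smul]
  calc ‖latticeKernel c (ξ - zEmb k)‖ * ‖r k‖
      ≤ (C' * (1 + ‖ξ - zEmb k‖) ^ (-(|s| + 2 * n))) *
          (C * ((1 + ‖ξ‖) ^ s * (1 + ‖ξ - zEmb k‖) ^ |s|)) := by
        refine mul_le_mul (h' _) ((h k).trans ?_) (norm_nonneg _) (by positivity)
        exact mul_le_mul_of_nonneg_left hp hC.le
    _ = C' * C * (1 + ‖ξ‖) ^ s * latticeWeight ξ k := by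
        rw [← hexp]
        ring

lemma summable_sampling (hr : SeqGrowth s r) (c : Fin n → ℕ) (ξ : Rn n) :
    Summable fun k => latticeKernel c (ξ - zEmb k) • r k := by
  obtain ⟨C, -, h⟩ := norm_latticeKernel_smul_le hr c
  obtain ⟨_, _, hw⟩ := exists_tsum_latticeWeight_le n
  exact Summable.of_norm_bounded ((hw ξ).1.mul_left _) (h ξ)

lemma SeqGrowth.sampling (hr : SeqGrowth s r) (c : Fin n → ℕ) : HasGrowth s (sampling c r) := by
  obtain ⟨C, hC, h⟩ := norm_latticeKernel_smul_le hr c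
  obtain ⟨D, hD, hw⟩ := exists_tsum_latticeWeight_le n
  refine ⟨C * D, by positivity, fun ξ => ?_⟩
  refine (tsum_of_norm_bounded ((hw ξ).1.hasSum.mul_left _) (h ξ)).trans ?_
  rw [mul_right_comm C D]
  exact mul_le_mul_of_nonneg_left (hw ξ).2 (by positivity)

lemma exists_summable_bound (hr : SeqGrowth s r) (c : Fin n → ℕ) (ξ₀ : Rn n) (R : ℝ) :
    ∃ u : (Fin n → ℤ) → ℝ, Summable u ∧ ∀ ξ, ‖ξ - ξ₀‖ ≤ R → ∀ k,
      ‖latticeKernel c (ξ - zEmb k) • r k‖ ≤ u k := by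
  obtain ⟨C, hC, h⟩ := norm_latticeKernel_smul_le hr c
  obtain ⟨_, _, hw⟩ := exists_tsum_latticeWeight_le n
  refine ⟨fun k => C * ((1 + ‖ξ₀‖) ^ s * (1 + R) ^ |s|) *
    (latticeWeight ξ₀ k * (1 + R) ^ (2 * n : ℝ)),
    ((hw ξ₀).1.mul_right _).mul_left _, fun ξ hξ k => (h ξ k).trans ?_⟩
  have hR : 0 ≤ R := (norm_nonneg _).trans hξ
  have h1 : ∀ t : ℝ, 0 ≤ t → (1 + ‖ξ - ξ₀‖) ^ t ≤ (1 + R) ^ t := fun t ht =>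
    Real.rpow_le_rpow (by positivity) (by linarith) ht
  have h2 : 0 ≤ latticeWeight ξ₀ k := by
    unfold latticeWeight
    positivity
  have h3 : 0 ≤ latticeWeight ξ k := by
    unfold latticeWeight
    positivity
  refine mul_le_mul (mul_le_mul_of_nonneg_left ?_ hC.le) ?_ h3 (by positivity)
  · exact (peetre s ξ ξ₀).trans
      (mul_le_mul_of_nonneg_left (h1 _ (abs_nonneg s)) (by positivity))
  · exact (latticeWeight_le ξ ξ₀ k).trans (mul_le_mul_of_nonneg_left (h1 _ (by positivity)) h2)

/-- Summation by parts. -/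
lemma tsum_sub_smul (hr : SeqGrowth s r) (c : Fin n → ℕ) (j : Fin n) (ξ : Rn n) :
    ∑' k, (latticeKernel c (ξ - zEmb k + EuclideanSpace.single j 1) -
      latticeKernel c (ξ - zEmb k)) • r k = sampling c (zdiff j r) ξ := by
  have h1 : ∀ k, ξ - zEmb k + EuclideanSpace.single j 1 =
      ξ + EuclideanSpace.single j 1 - zEmb k := fun k => by abel
  have hs := hr.shift (Pi.single j 1)
  have h2 : ∑' k, latticeKernel c (ξ + EuclideanSpace.single j 1 - zEmb k) • r k =
      ∑' k, latticeKernel c (ξ - zEmb k) • r (k + Pi.single j 1) := by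
    rw [← (Equiv.addRight (Pi.single j 1 : Fin n → ℤ)).tsum_eq]
    refine tsum_congr fun k => ?_
    rw [Equiv.coe_addRight, zEmb_add, zEmb_single, add_sub_add_right_eq_sub]
  simp only [sub_smul, h1]
  rw [(summable_sampling hr c _).tsum_sub (summable_sampling hr c _), h2,
    ← (summable_sampling hs c _).tsum_sub (summable_sampling hr c _)]
  simp only [sampling, zdiff, smul_sub]

lemma hasFDerivAt_sampling (hr : SeqGrowth s r) (c : Fin n → ℕ) (ξ : Rn n) :
    HasFDerivAt (sampling c r) (∑ j, (EuclideanSpace.proj j : Rn n →L[ℝ] ℝ).smulRight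
      (sampling (c + Pi.single j 1) (zdiff j r) ξ)) ξ := by
  set f' : (Fin n → ℤ) → Rn n → Rn n →L[ℝ] A := fun k η =>
    (latticeKernelGrad c (η - zEmb k)).smulRight (r k) with hf'
  have happ : ∀ k η j, f' k η (EuclideanSpace.single j 1) =
      (latticeKernel (c + Pi.single j 1) (η - zEmb k + EuclideanSpace.single j 1) -
        latticeKernel (c + Pi.single j 1) (η - zEmb k)) • r k := fun k η j => by
    simp only [hf', ContinuousLinearMap.smulRight_apply, latticeKernelGrad_single]
  choose u hu hbd using fun j : Fin n => exists_summable_bound hr (c + Pi.single j 1) ξ 2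
  have hbd' : ∀ k η, η ∈ Metric.ball ξ 1 → ‖f' k η‖ ≤ ∑ j, (u j k + u j k) := by
    intro k η hη
    rw [mem_ball_iff_norm] at hη
    refine (norm_clm_le_sum _).trans (Finset.sum_le_sum fun j _ => ?_)
    rw [happ, sub_smul]
    refine (norm_sub_le _ _).trans (add_le_add ?_ (hbd j η (by linarith) k))
    rw [show η - zEmb k + EuclideanSpace.single j 1 = η + EuclideanSpace.single j 1 - zEmb k by
      abel]
    refine hbd j _ ?_ k
    rw [add_sub_right_comm]
    refine (norm_add_le _ _).trans ?_
    rw [PiLp.norm_single, norm_one]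
    linarith
  have husum : Summable fun k => ∑ j, (u j k + u j k) :=
    summable_sum fun j _ => (hu j).add (hu j)
  have hmem := Metric.mem_ball_self (x := ξ) (zero_lt_one' ℝ)
  have hderiv : ∀ k η, η ∈ Metric.ball ξ 1 →
      HasFDerivAt (fun η => latticeKernel c (η - zEmb k) • r k) (f' k η) η := fun k η _ => by
    have h1 : HasFDerivAt (fun η => latticeKernel c (η - zEmb k))
        (latticeKernelGrad c (η - zEmb k)) η := by
      refine (HasFDerivAt.comp (f := fun η => η - zEmb k) η
        (hasFDerivAt_latticeKernel c (η - zEmb k))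
        ((hasFDerivAt_id η).sub_const (zEmb k))).congr_fderiv ?_
      exact ContinuousLinearMap.comp_id _
    exact h1.smul_const (r k)
  have key := hasFDerivAt_tsum_of_isPreconnected husum Metric.isOpen_ball
    (convex_ball ξ 1).isPreconnected hderiv hbd' hmem (summable_sampling hr c ξ) hmem
  refine HasFDerivAt.congr_fderiv (f := sampling c r) key (clm_ext_single fun j => ?_)
  have hsum : Summable fun k => f' k ξ :=
    Summable.of_norm_bounded husum fun k => hbd' k ξ hmem
  have h1 := (ContinuousLinearMap.apply ℝ A (EuclideanSpace.single j 1 : Rn n)).map_tsum hsum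
  simp only [ContinuousLinearMap.apply_apply] at h1
  rw [h1]
  simp only [happ, tsum_sub_smul hr, _root_.sum_apply, ContinuousLinearMap.smulRight_apply]
  rw [Finset.sum_eq_single j] <;> simp +contextual

lemma sampling_mem_smoothMaps (hr : SeqGrowth s r) (c : Fin n → ℕ) :
    sampling c r ∈ SmoothMaps n A := by
  intro N
  induction N generalizing c r with
  | zero =>
    exact contDiff_zero.2 (continuous_iff_continuousAt.2 fun ξ =>
      (hasFDerivAt_sampling hr c ξ).continuousAt)
  | succ N ih =>
    rw [Nat.cast_add, Nat.cast_one, contDiff_succ_iff_fderiv]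
    refine ⟨fun ξ => (hasFDerivAt_sampling hr c ξ).differentiableAt, by simp, ?_⟩
    rw [funext fun ξ => (hasFDerivAt_sampling hr c ξ).fderiv]
    refine ContDiff.sum fun j _ => ?_
    exact (ContinuousLinearMap.smulRightL ℝ (Rn n) A
      (EuclideanSpace.proj j : Rn n →L[ℝ] ℝ)).contDiff.comp (ih (hr.zdiff j) _)

lemma pd_sampling (hr : SeqGrowth s r) (c : Fin n → ℕ) (j : Fin n) :
    pd j (sampling c r) = sampling (c + Pi.single j 1) (zdiff j r) := by
  funext ξ
  rw [pd, (hasFDerivAt_sampling hr c ξ).fderiv]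
  simp only [_root_.sum_apply, ContinuousLinearMap.smulRight_apply]
  rw [Finset.sum_eq_single j] <;> simp +contextual

lemma sampling_zEmb (r : (Fin n → ℤ) → A) (k : Fin n → ℤ) : sampling 0 r (zEmb k) = r k := by
  rw [sampling, tsum_eq_single k]
  · rw [← zEmb_sub, latticeKernel_zero, if_pos (sub_self k), one_smul]
  · intro l hl
    rw [← zEmb_sub, latticeKernel_zero, if_neg (sub_ne_zero.2 hl.symm), zero_smul]

end Sampling

/-- Sequences of smooth vectors all of whose `δ`-derivatives are `O((1+|k|)^s)`. -/
def SeqFam (αa : Rn n → (A ≃⋆ₐ[ℂ] A)) (s : ℝ) : Set ((Fin n → ℤ) → A) :=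
  {r | (∀ k, r k ∈ SmoothSet αa) ∧
    ∀ w : List (Fin n), SeqGrowth s fun k => applyWord (δd αa) w (r k)}

section Existence

variable {αa : Rn n → (A ≃⋆ₐ[ℂ] A)} {s : ℝ} {r : (Fin n → ℤ) → A}

lemma SeqFam.growth (hr : r ∈ SeqFam αa s) : SeqGrowth s r := hr.2 []

lemma δd_comp_mem_seqFam (hαadd : ∀ s t (u : A), αa (s + t) u = αa s (αa t u))
    (hαiso : ∀ s (u : A), ‖αa s u‖ = ‖u‖) (j : Fin n) (hr : r ∈ SeqFam αa s) :
    (fun k => δd αa j (r k)) ∈ SeqFam αa s := by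
  refine ⟨fun k => δd_mem_smoothSet hαadd hαiso j _ (hr.1 k), fun w => ?_⟩
  simpa [applyWord_append] using hr.2 (w ++ [j])

lemma δword_comp_mem_seqFam (hαadd : ∀ s t (u : A), αa (s + t) u = αa s (αa t u))
    (hαiso : ∀ s (u : A), ‖αa s u‖ = ‖u‖) (w : List (Fin n)) (hr : r ∈ SeqFam αa s) :
    (fun k => applyWord (δd αa) w (r k)) ∈ SeqFam αa s := by
  induction w with
  | nil => exact hr
  | cons j w ih => exact δd_comp_mem_seqFam hαadd hαiso j ih

lemma δword_zdiff (hαadd : ∀ s t (u : A), αa (s + t) u = αa s (αa t u))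
    (hαiso : ∀ s (u : A), ‖αa s u‖ = ‖u‖) (w : List (Fin n)) (j : Fin n)
    (hr : ∀ k, r k ∈ SmoothSet αa) :
    (fun k => applyWord (δd αa) w (zdiff j r k)) =
      zdiff j fun k => applyWord (δd αa) w (r k) :=
  funext fun _ => δword_sub hαadd hαiso w (hr _) (hr _)

lemma zdiff_mem_seqFam (hαadd : ∀ s t (u : A), αa (s + t) u = αa s (αa t u))
    (hαiso : ∀ s (u : A), ‖αa s u‖ = ‖u‖) (j : Fin n) (hr : r ∈ SeqFam αa s) :
    zdiff j r ∈ SeqFam αa s := by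
  refine ⟨fun k => sub_mem_smoothSet (hr.1 _) (hr.1 _), fun w => ?_⟩
  rw [δword_zdiff hαadd hαiso w j hr.1]
  exact (hr.2 w).zdiff j

lemma sampling_mem_gradGraph (hαadd : ∀ s t (u : A), αa (s + t) u = αa s (αa t u))
    (hαiso : ∀ s (u : A), ‖αa s u‖ = ‖u‖) (c : Fin n → ℕ) (hr : r ∈ SeqFam αa s) (ξ : Rn n) :
    (sampling c r ξ, fun j => sampling c (fun k => δd αa j (r k)) ξ) ∈ gradGraph αa := by
  have h : HasSum (fun k => latticeKernel c (ξ - zEmb k) •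
      ((r k, fun j => δd αa j (r k)) : A × (Fin n → A)))
      (sampling c r ξ, fun j => sampling c (fun k => δd αa j (r k)) ξ) :=
    (summable_sampling (SeqFam.growth hr) c ξ).hasSum.prodMk (Pi.hasSum.2 fun j =>
      (summable_sampling (SeqFam.growth (δd_comp_mem_seqFam hαadd hαiso j hr)) c ξ).hasSum)
  exact (isClosed_gradGraph hαadd hαiso).mem_of_tendsto h (Eventually.of_forall fun F =>
    (gradGraph αa).sum_mem fun k _ =>
      (gradGraph αa).smul_mem _ (grad_mem_gradGraph (hr.1 k)))

lemma sampling_mem_smoothSet (hαadd : ∀ s t (u : A), αa (s + t) u = αa s (αa t u))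
    (hαiso : ∀ s (u : A), ‖αa s u‖ = ‖u‖) (c : Fin n → ℕ) (hr : r ∈ SeqFam αa s) (ξ : Rn n) :
    sampling c r ξ ∈ SmoothSet αa := by
  refine subset_smoothSet hαadd hαiso (S := {u | ∃ q ∈ SeqFam αa s, u = sampling c q ξ}) ?_
    ⟨r, hr, rfl⟩
  rintro _ ⟨q, hq, rfl⟩
  exact ⟨_, sampling_mem_gradGraph hαadd hαiso c hq ξ, fun j =>
    ⟨_, δd_comp_mem_seqFam hαadd hαiso j hq, rfl⟩⟩

lemma δword_sampling (hαadd : ∀ s t (u : A), αa (s + t) u = αa s (αa t u))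
    (hαiso : ∀ s (u : A), ‖αa s u‖ = ‖u‖) (w : List (Fin n)) (c : Fin n → ℕ)
    (hr : r ∈ SeqFam αa s) (ξ : Rn n) :
    applyWord (δd αa) w (sampling c r ξ) = sampling c (fun k => applyWord (δd αa) w (r k)) ξ := by
  induction w with
  | nil => rfl
  | cons j w ih =>
    rw [applyWord_cons, ih]
    exact δd_of_mem_gradGraph
      (sampling_mem_gradGraph hαadd hαiso c (δword_comp_mem_seqFam hαadd hαiso w hr) ξ) j

lemma sampling_mem_smoothFam (hαadd : ∀ s t (u : A), αa (s + t) u = αa s (αa t u))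
    (hαiso : ∀ s (u : A), ‖αa s u‖ = ‖u‖) (c : Fin n → ℕ) (hr : r ∈ SeqFam αa s) :
    sampling c r ∈ SmoothFam αa := by
  refine ⟨sampling_mem_smoothSet hαadd hαiso c hr, fun w => ?_⟩
  simp only [δword_sampling hαadd hαiso w c hr]
  exact sampling_mem_smoothMaps (hr.2 w) c

/-- `∂_ξ`-derivatives of a sampling series are sampling series of differences. -/
lemma pdWord_sampling (hαadd : ∀ s t (u : A), αa (s + t) u = αa s (αa t u))
    (hαiso : ∀ s (u : A), ‖αa s u‖ = ‖u‖) (w v : List (Fin n)) (c : Fin n → ℕ)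
    (hr : r ∈ SeqFam αa s) : ∃ c' : Fin n → ℕ,
    applyWord pd v (sampling c fun k => applyWord (δd αa) w (r k)) =
      sampling c' fun k => applyWord (δd αa) w (applyWord zdiff v r k) := by
  refine (applyWord_rel (S := pd) (P := zdiff)
    (R := fun (f : Rn n → A) q => q ∈ SeqFam αa s ∧ ∃ c' : Fin n → ℕ,
      f = sampling c' fun k => applyWord (δd αa) w (q k)) ?_ v ⟨hr, c, rfl⟩).2
  rintro j _ q ⟨hq, c', rfl⟩
  refine ⟨zdiff_mem_seqFam hαadd hαiso j hq, c' + Pi.single j 1, ?_⟩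
  rw [pd_sampling (hq.2 w), δword_zdiff hαadd hαiso w j hq.1]

lemma zdiffPow_zero (r : (Fin n → ℤ) → A) : zdiffPow 0 r = r := by
  have : multiWord (0 : Fin n → ℕ) = [] := List.length_eq_zero_iff.1 (by simp [length_multiWord, mdeg])
  rw [zdiffPow_eq_applyWord, this, applyWord_nil]

lemma IsToroidal.mem_seqFam (hαadd : ∀ s t (u : A), αa (s + t) u = αa s (αa t u))
    (hαiso : ∀ s (u : A), ‖αa s u‖ = ‖u‖) {m : ℝ} (hr : IsToroidal αa m r) :
    r ∈ SeqFam αa m := by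
  refine ⟨hr.1, fun w => ?_⟩
  obtain ⟨C, hC, h⟩ := hr.2 (fun j => w.count j) 0
  refine ⟨C, hC, fun k => ?_⟩
  have := h k
  rw [zdiffPow_zero, znorm_eq] at this
  simpa [δword_eq_δpow hαadd hαiso w (hr.1 k), mdeg] using this

lemma IsToroidal.isSymbol_sampling (hαadd : ∀ s t (u : A), αa (s + t) u = αa s (αa t u))
    (hαiso : ∀ s (u : A), ‖αa s u‖ = ‖u‖) {m : ℝ} (hr : IsToroidal αa m r) :
    IsSymbol αa m (sampling 0 r) := by
  have hfam := hr.mem_seqFam hαadd hαiso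
  rw [isSymbol_iff hαadd hαiso]
  refine ⟨sampling_mem_smoothFam hαadd hαiso 0 hfam, fun a b => ?_⟩
  simp only [δpow_eq_applyWord, pdPow_eq_applyWord, δword_sampling hαadd hαiso _ _ hfam]
  obtain ⟨c', hc'⟩ := pdWord_sampling hαadd hαiso (multiWord a) (multiWord b) 0 hfam
  rw [hc']
  refine SeqGrowth.sampling ?_ c'
  obtain ⟨C, hC, h⟩ := hr.2 a b
  refine ⟨C, hC, fun k => ?_⟩
  simpa only [δpow_eq_applyWord, zdiffPow_eq_applyWord, znorm_eq] using h k

end Existence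

/-- every toroidal symbol `(ρ_k)_{k∈ℤⁿ} ∈ 𝕊^m(ℤⁿ;𝒜_θ)` extends to a standard
symbol `ρ̃ ∈ 𝕊^m(ℝⁿ;𝒜_θ)` with `ρ̃(k) = ρ_k` for all `k ∈ ℤⁿ`, and the extension is unique
modulo `𝒮(ℝⁿ;𝒜_θ)`. -/
theorem statement_19
    {n : ℕ} (hn : 2 ≤ n)
    {A : Type} [NormedRing A] [StarRing A] [CStarRing A] [NormedAlgebra ℂ A]
    [StarModule ℂ A] [CompleteSpace A]
    (αa : Rn n → (A ≃⋆ₐ[ℂ] A))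
    (hαadd : ∀ s t (u : A), αa (s + t) u = αa s (αa t u))
    (hα0 : ∀ u : A, αa 0 u = u)
    (hαiso : ∀ s (u : A), ‖αa s u‖ = ‖u‖)
    (m : ℝ) (ρk : (Fin n → ℤ) → A)
    (hρk : IsToroidal αa m ρk) :
    -- existence of a standard symbol extending `ρ_k`
    (∃ ρ : Rn n → A, IsSymbol αa m ρ ∧ ∀ k, ρ (zEmb k) = ρk k) ∧
    -- uniqueness modulo `𝒮(ℝⁿ;𝒜_θ)`
    (∀ ρ₁ ρ₂ : Rn n → A, IsSymbol αa m ρ₁ → IsSymbol αa m ρ₂ →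
      (∀ k, ρ₁ (zEmb k) = ρk k) → (∀ k, ρ₂ (zEmb k) = ρk k) →
      IsSchwartzSym αa (ρ₁ - ρ₂)) := by
  exact ⟨⟨sampling 0 ρk, hρk.isSymbol_sampling hαadd hαiso, sampling_zEmb ρk⟩,
    fun _ _ h₁ h₂ e₁ e₂ => isSchwartzSym_sub hαadd hαiso h₁ h₂ fun k => (e₁ k).trans (e₂ k).symm⟩
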